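/- arXiv:hep-th/0611012 — 8 statements merged into one kernel-verified Lean document; each statement's English description precedes it below -/
import Mathlib

section
/- Yang–Baxter equation for the SU(N) R-matrix: for all θ1, θ2, θ3 ∈ ℂ with θ1−θ2 ≠ iη, θ1−θ3 ≠ iη and θ2−θ3 ≠ iη, the operators on (ℂ^N)^{⊗3} satisfy S̃_{12}(θ1−θ2) ∘ S̃_{13}(θ1−θ3) ∘ S̃_{23}(θ2−θ3) = S̃_{23}(θ2−θ3) ∘ S̃_{13}(θ1−θ3) ∘ S̃_{12}(θ1−θ2). -/
open Complex Matrix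

noncomputable section

/-- η = 2π/N, as a complex number. -/
def etaC (N : ℕ) : ℂ := 2 * (Real.pi : ℂ) / N

/-- The permutation operator P on ℂ^N ⊗ ℂ^N, P(u ⊗ v) = v ⊗ u. -/
def permOp (N : ℕ) : Matrix (Fin N × Fin N) (Fin N × Fin N) ℂ :=
  fun p q => if p.1 = q.2 ∧ p.2 = q.1 then 1 else 0

/-- The SU(N) R-matrix S̃(θ) = (θ·id − iη·P)/(θ − iη). -/
def Stilde (N : ℕ) (θ : ℂ) : Matrix (Fin N × Fin N) (Fin N × Fin N) ℂ :=
  (θ - Complex.I * etaC N)⁻¹ •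
    (θ • (1 : Matrix (Fin N × Fin N) (Fin N × Fin N) ℂ) - (Complex.I * etaC N) • permOp N)

/-- Embedding of an operator on ℂ^N ⊗ ℂ^N into factors 1 and 2 of (ℂ^N)^{⊗3}. -/
def act12 (N : ℕ) (M : Matrix (Fin N × Fin N) (Fin N × Fin N) ℂ) :
    Matrix (Fin N × Fin N × Fin N) (Fin N × Fin N × Fin N) ℂ :=
  fun p q => M (p.1, p.2.1) (q.1, q.2.1) * (if p.2.2 = q.2.2 then 1 else 0)

/-- Embedding of an operator on ℂ^N ⊗ ℂ^N into factors 1 and 3 of (ℂ^N)^{⊗3}. -/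
def act13 (N : ℕ) (M : Matrix (Fin N × Fin N) (Fin N × Fin N) ℂ) :
    Matrix (Fin N × Fin N × Fin N) (Fin N × Fin N × Fin N) ℂ :=
  fun p q => M (p.1, p.2.2) (q.1, q.2.2) * (if p.2.1 = q.2.1 then 1 else 0)

/-- Embedding of an operator on ℂ^N ⊗ ℂ^N into factors 2 and 3 of (ℂ^N)^{⊗3}. -/
def act23 (N : ℕ) (M : Matrix (Fin N × Fin N) (Fin N × Fin N) ℂ) :
    Matrix (Fin N × Fin N × Fin N) (Fin N × Fin N × Fin N) ℂ :=
  fun p q => M (p.2.1, p.2.2) (q.2.1, q.2.2) * (if p.1 = q.1 then 1 else 0)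

/-- The swap of tensor factors 1 and 2 on the basis of (ℂ^N)^{⊗3}. -/
def swap12 (α : Type*) : Equiv.Perm (α × α × α) :=
  Function.Involutive.toPerm (fun p => (p.2.1, p.1, p.2.2)) fun _ => rfl

lemma swap12_apply {α : Type*} (p : α × α × α) : swap12 α p = (p.2.1, p.1, p.2.2) := rfl

/-- The swap of tensor factors 1 and 3 on the basis of (ℂ^N)^{⊗3}. -/
def swap13 (α : Type*) : Equiv.Perm (α × α × α) :=
  Function.Involutive.toPerm (fun p => (p.2.2, p.2.1, p.1)) fun _ => rfl

lemma swap13_apply {α : Type*} (p : α × α × α) : swap13 α p = (p.2.2, p.2.1, p.1) := rfl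

/-- The swap of tensor factors 2 and 3 on the basis of (ℂ^N)^{⊗3}. -/
def swap23 (α : Type*) : Equiv.Perm (α × α × α) :=
  Function.Involutive.toPerm (fun p => (p.1, p.2.2, p.2.1)) fun _ => rfl

lemma swap23_apply {α : Type*} (p : α × α × α) : swap23 α p = (p.1, p.2.2, p.2.1) := rfl

lemma act12_Stilde (N : ℕ) (θ : ℂ) :
    act12 N (Stilde N θ) = (θ - I * etaC N)⁻¹ •
      (θ • 1 - (I * etaC N) • (swap12 (Fin N)).permMatrix ℂ) := by
  ext ⟨a, b, c⟩ ⟨d, e, f⟩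
  simp [act12, Stilde, permOp, swap12_apply, PEquiv.toMatrix_apply, Matrix.one_apply]
  grind

lemma act13_Stilde (N : ℕ) (θ : ℂ) :
    act13 N (Stilde N θ) = (θ - I * etaC N)⁻¹ •
      (θ • 1 - (I * etaC N) • (swap13 (Fin N)).permMatrix ℂ) := by
  ext ⟨a, b, c⟩ ⟨d, e, f⟩
  simp [act13, Stilde, permOp, swap13_apply, PEquiv.toMatrix_apply, Matrix.one_apply]
  grind

lemma act23_Stilde (N : ℕ) (θ : ℂ) :
    act23 N (Stilde N θ) = (θ - I * etaC N)⁻¹ •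
      (θ • 1 - (I * etaC N) • (swap23 (Fin N)).permMatrix ℂ) := by
  ext ⟨a, b, c⟩ ⟨d, e, f⟩
  simp [act23, Stilde, permOp, swap23_apply, PEquiv.toMatrix_apply, Matrix.one_apply]
  grind

/-- The Yang–Baxter equation for rational R-matrices built from elements satisfying the
conjugation relations of the three transpositions in the symmetric group on three letters. -/
lemma yang_baxter_of_mul_eq {R A : Type*} [CommRing R] [Ring A] [Algebra R A] {a b c : A}
    (hab : a * b = b * c) (hca : c * a = b * c) (hba : b * a = c * b) (hac : a * c = c * b)
    (x z h : R) :
    (x • 1 - h • a) * ((x + z) • 1 - h • b) * (z • 1 - h • c) =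
      (z • 1 - h • c) * ((x + z) • 1 - h • b) * (x • 1 - h • a) := by
  have hbcc : b * c * c = c * b * a := by
    rw [← hca, mul_assoc, hac, mul_assoc c b, hba]
  simp only [sub_mul, mul_sub, smul_mul_assoc, mul_smul_comm, one_mul, mul_one, hbcc, hab, hca,
    hba, hac]
  module

/-- Yang–Baxter equation for the SU(N) R-matrix. -/
theorem yang_baxter (N : ℕ) (hN : 2 ≤ N) (θ1 θ2 θ3 : ℂ)
    (h12 : θ1 - θ2 ≠ Complex.I * etaC N)
    (h13 : θ1 - θ3 ≠ Complex.I * etaC N)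
    (h23 : θ2 - θ3 ≠ Complex.I * etaC N) :
    act12 N (Stilde N (θ1 - θ2)) * act13 N (Stilde N (θ1 - θ3)) * act23 N (Stilde N (θ2 - θ3)) =
      act23 N (Stilde N (θ2 - θ3)) * act13 N (Stilde N (θ1 - θ3)) *
        act12 N (Stilde N (θ1 - θ2)) := by
  have hab : (swap12 (Fin N)).permMatrix ℂ * (swap13 (Fin N)).permMatrix ℂ =
      (swap13 (Fin N)).permMatrix ℂ * (swap23 (Fin N)).permMatrix ℂ := by
    simp only [← Matrix.permMatrix_mul]
    rfl
  have hca : (swap23 (Fin N)).permMatrix ℂ * (swap12 (Fin N)).permMatrix ℂ =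
      (swap13 (Fin N)).permMatrix ℂ * (swap23 (Fin N)).permMatrix ℂ := by
    simp only [← Matrix.permMatrix_mul]
    rfl
  have hba : (swap13 (Fin N)).permMatrix ℂ * (swap12 (Fin N)).permMatrix ℂ =
      (swap23 (Fin N)).permMatrix ℂ * (swap13 (Fin N)).permMatrix ℂ := by
    simp only [← Matrix.permMatrix_mul]
    rfl
  have hac : (swap12 (Fin N)).permMatrix ℂ * (swap23 (Fin N)).permMatrix ℂ =
      (swap23 (Fin N)).permMatrix ℂ * (swap13 (Fin N)).permMatrix ℂ := by
    simp only [← Matrix.permMatrix_mul]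
    rfl
  have key := yang_baxter_of_mul_eq hab hca hba hac (θ1 - θ2) (θ2 - θ3) (I * etaC N)
  rw [sub_add_sub_cancel] at key
  simp only [act12_Stilde, act13_Stilde, act23_Stilde, smul_mul_assoc, mul_smul_comm, key]
  module
end
end

section
/- Bound-state crossing identities for the amplitudes: for every θ ∈ ℂ for which all factors occurring below are defined (no Gamma argument is a pole and no denominator vanishes), the following three identities hold: (i) ∏_{j=1}^{N−1} b(θ + iπ − j·iη) = (−1)^{N−1}·a(iπ − θ); (ii) (∏_{j=1}^{N−2} b(θ + iπ − j·iη))·a(θ − iπ + iη) = (−1)^{N−1}·b(iπ − θ); (iii) −(∏_{j=1}^{N−2} b(θ + iπ − j·iη))·c(θ − iπ + iη) = (−1)^{N−1}·c(iπ − θ). -/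
open Complex

noncomputable section

/-- 2πi. -/
def twoPiI : ℂ := 2 * (Real.pi : ℂ) * Complex.I

/-- `z` is not a pole of the Gamma function. -/
def GammaDefined (z : ℂ) : Prop := ∀ m : ℕ, z ≠ -(m : ℂ)

/-- The highest weight S-matrix amplitude a(θ). -/
def aAmp (N : ℕ) (θ : ℂ) : ℂ :=
  -(Complex.Gamma (1 - θ / twoPiI) * Complex.Gamma (1 - 1 / N + θ / twoPiI)) /
    (Complex.Gamma (1 + θ / twoPiI) * Complex.Gamma (1 - 1 / N - θ / twoPiI))

/-- The amplitude b(θ) = a(θ)·θ/(θ − iη). -/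
def bAmp (N : ℕ) (θ : ℂ) : ℂ := aAmp N θ * θ / (θ - Complex.I * etaC N)

/-- The amplitude c(θ) = −iη·a(θ)/(θ − iη). -/
def cAmp (N : ℕ) (θ : ℂ) : ℂ := -(Complex.I * etaC N) * aAmp N θ / (θ - Complex.I * etaC N)

/-- All Gamma factors in a(θ) are defined (no Gamma argument is a pole) and the
denominator Gamma factors are nonzero. -/
def aDefined (N : ℕ) (θ : ℂ) : Prop :=
  GammaDefined (1 - θ / twoPiI) ∧ GammaDefined (1 - 1 / N + θ / twoPiI) ∧
    GammaDefined (1 + θ / twoPiI) ∧ GammaDefined (1 - 1 / N - θ / twoPiI) ∧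
    Complex.Gamma (1 + θ / twoPiI) ≠ 0 ∧ Complex.Gamma (1 - 1 / N - θ / twoPiI) ≠ 0

/-- The amplitudes b(θ), c(θ) are defined: a(θ) is defined and θ − iη ≠ 0. -/
def bDefined (N : ℕ) (θ : ℂ) : Prop := aDefined N θ ∧ θ ≠ Complex.I * etaC N

theorem twoPiI_ne_zero : twoPiI ≠ 0 := two_pi_I_ne_zero

theorem I_mul_etaC (N : ℕ) : I * etaC N = twoPiI * (1 / N) := by
  unfold etaC twoPiI
  ring

theorem aAmp_twoPiI_mul (N : ℕ) (x : ℂ) :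
    aAmp N (twoPiI * x) =
      -(Gamma (1 - x) * Gamma (1 - 1 / N + x)) / (Gamma (1 + x) * Gamma (1 - 1 / N - x)) := by
  rw [aAmp, mul_div_cancel_left₀ _ twoPiI_ne_zero]

theorem bAmp_twoPiI_mul (N : ℕ) (x : ℂ) :
    bAmp N (twoPiI * x) = aAmp N (twoPiI * x) * x / (x - 1 / N) := by
  rw [bAmp, I_mul_etaC, ← mul_sub, mul_left_comm, mul_div_mul_left _ _ twoPiI_ne_zero]

theorem cAmp_twoPiI_mul (N : ℕ) (x : ℂ) :
    cAmp N (twoPiI * x) = -(1 / N) * aAmp N (twoPiI * x) / (x - 1 / N) := by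
  rw [cAmp, I_mul_etaC, ← mul_sub, ← mul_neg, mul_assoc, mul_div_mul_left _ _ twoPiI_ne_zero]

theorem bDefined.Gamma_ne_zero {N : ℕ} {x : ℂ} (h : bDefined N (twoPiI * x)) :
    Gamma (1 + x) ≠ 0 ∧ Gamma (1 - 1 / N - x) ≠ 0 := by
  have h' := h.1.2.2.2.2
  rwa [mul_div_cancel_left₀ _ twoPiI_ne_zero] at h'

theorem bDefined.sub_ne_zero {N : ℕ} {x : ℂ} (h : bDefined N (twoPiI * x)) : x - 1 / N ≠ 0 := by
  intro hx
  exact h.2 (by rw [I_mul_etaC, sub_eq_zero.1 hx])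

/-- The recursion of the Gamma function absorbs the rational factor of `b` into the Gamma factors,
which brings `b` into a form whose products along steps of `1 / N` telescope. -/
theorem bAmp_mul_Gamma {N : ℕ} {x : ℂ} (h : bDefined N (twoPiI * x)) (hx : x ≠ 0) :
    bAmp N (twoPiI * x) * (Gamma x * Gamma (1 - 1 / N - x)) =
      -(Gamma (x - 1 / N) * Gamma (1 - x)) := by
  obtain ⟨h₁, h₂⟩ := h.Gamma_ne_zero
  have h₃ := h.sub_ne_zero
  have e₁ : Gamma (1 + x) = x * Gamma x := by rw [add_comm, Gamma_add_one x hx]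
  have e₂ : Gamma (1 - 1 / N + x) = (x - 1 / N) * Gamma (x - 1 / N) := by
    rw [← Gamma_add_one _ h₃]
    congr 1
    ring
  have h₄ : Gamma x ≠ 0 := by
    rw [e₁] at h₁
    exact right_ne_zero_of_mul h₁
  rw [bAmp_twoPiI_mul, aAmp_twoPiI_mul, e₁, e₂]
  generalize x - 1 / (N : ℂ) = d at *
  field_simp

theorem sub_div_ne_zero_of_bDefined {N M : ℕ} {y : ℂ}
    (hb : ∀ j ∈ Finset.Icc 1 M, bDefined N (twoPiI * (y - j / N))) (h₁ : y - 1 / N ≠ 0) :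
    y - (M + 1 : ℕ) / N ≠ 0 := by
  rcases M with _ | k
  · simpa using h₁
  · have h := (hb (k + 1) (by simp)).sub_ne_zero
    rwa [sub_sub, ← add_div, ← Nat.cast_succ] at h

theorem prod_bAmp_mul_Gamma {N M : ℕ} {y : ℂ}
    (hb : ∀ j ∈ Finset.Icc 1 M, bDefined N (twoPiI * (y - j / N))) (h₁ : y - 1 / N ≠ 0) :
    (∏ j ∈ Finset.Icc 1 M, bAmp N (twoPiI * (y - j / N))) *
        (Gamma (y - 1 / N) * Gamma (1 - y)) =
      (-1) ^ M * (Gamma (y - (M + 1 : ℕ) / N) * Gamma (1 - (y - M / N))) := by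
  induction M with
  | zero => simp
  | succ k ih =>
    have hb' : ∀ j ∈ Finset.Icc 1 k, bDefined N (twoPiI * (y - j / N)) := fun j hj =>
      hb j (Finset.Icc_subset_Icc_right k.le_succ hj)
    have h := bAmp_mul_Gamma (hb (k + 1) (by simp)) (sub_div_ne_zero_of_bDefined hb' h₁)
    have e₁ : 1 - 1 / (N : ℂ) - (y - (k + 1 : ℕ) / N) = 1 - (y - k / N) := by
      push_cast
      ring
    have e₂ : y - (k + 1 : ℕ) / (N : ℂ) - 1 / N = y - (k + 1 + 1 : ℕ) / N := by
      push_cast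
      ring
    rw [e₁, e₂] at h
    rw [Finset.prod_Icc_succ_top (by omega), pow_succ]
    linear_combination bAmp N (twoPiI * (y - (k + 1 : ℕ) / N)) * ih hb' + (-1) ^ k * h

/-- Bound-state crossing identities for the amplitudes. -/
theorem boundState_crossing_amplitudes (N : ℕ) (hN : 2 ≤ N) (θ : ℂ)
    (hb : ∀ j ∈ Finset.Icc 1 (N - 1),
      bDefined N (θ + (Real.pi : ℂ) * Complex.I - (j : ℂ) * (Complex.I * etaC N)))
    (hbs : bDefined N (θ - (Real.pi : ℂ) * Complex.I + Complex.I * etaC N))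
    (hcr : bDefined N ((Real.pi : ℂ) * Complex.I - θ)) :
    (∏ j ∈ Finset.Icc 1 (N - 1),
        bAmp N (θ + (Real.pi : ℂ) * Complex.I - (j : ℂ) * (Complex.I * etaC N))) =
      (-1 : ℂ) ^ (N - 1) * aAmp N ((Real.pi : ℂ) * Complex.I - θ) ∧
    (∏ j ∈ Finset.Icc 1 (N - 2),
        bAmp N (θ + (Real.pi : ℂ) * Complex.I - (j : ℂ) * (Complex.I * etaC N))) *
        aAmp N (θ - (Real.pi : ℂ) * Complex.I + Complex.I * etaC N) =
      (-1 : ℂ) ^ (N - 1) * bAmp N ((Real.pi : ℂ) * Complex.I - θ) ∧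
    -(∏ j ∈ Finset.Icc 1 (N - 2),
        bAmp N (θ + (Real.pi : ℂ) * Complex.I - (j : ℂ) * (Complex.I * etaC N))) *
        cAmp N (θ - (Real.pi : ℂ) * Complex.I + Complex.I * etaC N) =
      (-1 : ℂ) ^ (N - 1) * cAmp N ((Real.pi : ℂ) * Complex.I - θ) := by
  have hN₀ : (N : ℂ) ≠ 0 := by exact_mod_cast (by omega : N ≠ 0)
  obtain ⟨x, rfl⟩ : ∃ x, θ = twoPiI * x := ⟨θ / twoPiI, (mul_div_cancel₀ _ twoPiI_ne_zero).symm⟩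
  have e_pi : (Real.pi : ℂ) * I = twoPiI * (1 / 2) := by
    unfold twoPiI
    ring
  have e_j : ∀ j : ℕ, twoPiI * x + (Real.pi : ℂ) * I - (j : ℂ) * (I * etaC N) =
      twoPiI * (x + 1 / 2 - j / N) := fun j => by
    rw [e_pi, I_mul_etaC]
    ring
  have e_w : twoPiI * x - (Real.pi : ℂ) * I + I * etaC N = twoPiI * (x - 1 / 2 + 1 / N) := by
    rw [e_pi, I_mul_etaC]
    ring
  have e_c : (Real.pi : ℂ) * I - twoPiI * x = twoPiI * (1 / 2 - x) := by
    rw [e_pi]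
    ring
  simp only [e_j, e_w, e_c] at hb hbs hcr ⊢
  obtain ⟨n, rfl⟩ : ∃ n, N = n + 2 := ⟨N - 2, by omega⟩
  simp only [Nat.add_sub_cancel, show n + 2 - 1 = n + 1 by omega] at hb ⊢
  set e : ℂ := 1 / (n + 2 : ℕ) with he
  have hn : (n : ℂ) / (n + 2 : ℕ) = 1 - 2 * e := by
    rw [he]
    field_simp
    push_cast
    ring
  have hn₁ : ((n + 1 : ℕ) : ℂ) / (n + 2 : ℕ) = 1 - e := by
    rw [Nat.cast_succ, add_div, hn, ← he]
    ring
  have hn₂ : ((n + 1 + 1 : ℕ) : ℂ) / (n + 2 : ℕ) = 1 := div_self hN₀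
  clear_value e
  have hb' : ∀ j ∈ Finset.Icc 1 n, bDefined (n + 2) (twoPiI * (x + 1 / 2 - j / (n + 2 : ℕ))) :=
    fun j hj => hb j (Finset.Icc_subset_Icc_right n.le_succ hj)
  obtain ⟨g₁, g₂⟩ := hcr.Gamma_ne_zero
  obtain ⟨g₃, g₄⟩ := hbs.Gamma_ne_zero
  have e₁ : 1 - e - (1 / 2 - x) = x + 1 / 2 - e := by ring
  rw [← he, e₁] at g₂
  have hx₁ : x + 1 / 2 - e ≠ 0 := fun h => g₂ (by rw [h, Gamma_zero])
  have hx : x - 1 / 2 ≠ 0 := by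
    have h := sub_div_ne_zero_of_bDefined hb (he ▸ hx₁)
    rw [hn₂] at h
    convert h using 1
    ring
  have hx' : 1 / 2 - x ≠ 0 := by
    rw [← neg_sub]
    exact neg_ne_zero.2 hx
  have hw : x - 1 / 2 + e ≠ 0 := by
    have h := sub_div_ne_zero_of_bDefined hb' (he ▸ hx₁)
    rw [hn₁] at h
    convert h using 1
    ring
  have P₁ := prod_bAmp_mul_Gamma hb (he ▸ hx₁)
  have P₂ := prod_bAmp_mul_Gamma hb' (he ▸ hx₁)
  rw [← he, hn₁, hn₂] at P₁
  rw [← he, hn, hn₁] at P₂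
  have G₁ : Gamma (1 + (1 / 2 - x)) = (1 / 2 - x) * Gamma (1 / 2 - x) := by
    rw [add_comm, Gamma_add_one _ hx']
  have G₂ : Gamma (1 / 2 + x) = (x - 1 / 2) * Gamma (x - 1 / 2) := by
    rw [← Gamma_add_one _ hx]
    congr 1
    ring
  have G₃ : Gamma (1 + (x - 1 / 2 + e)) = (x - 1 / 2 + e) * Gamma (x - 1 / 2 + e) := by
    rw [add_comm, Gamma_add_one _ hw]
  have g₅ : Gamma (1 / 2 - x) ≠ 0 := by
    rw [G₁] at g₁
    exact right_ne_zero_of_mul g₁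
  have g₆ : Gamma (x - 1 / 2 + e) ≠ 0 := by
    rw [G₃] at g₃
    exact right_ne_zero_of_mul g₃
  have hA : aAmp (n + 2) (twoPiI * (1 / 2 - x)) * (Gamma (x + 1 / 2 - e) * Gamma (1 / 2 - x)) =
      Gamma (x - 1 / 2) * Gamma (3 / 2 - e - x) := by
    rw [aAmp_twoPiI_mul, ← he, e₁, G₁, show 1 - (1 / 2 - x) = 1 / 2 + x by ring, G₂,
      show 1 - e + (1 / 2 - x) = 3 / 2 - e - x by ring,
      div_mul_eq_mul_div, div_eq_iff (mul_ne_zero (mul_ne_zero hx' g₅) g₂)]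
    ring
  have hw' : 1 / 2 - x - e ≠ 0 := he ▸ hcr.sub_ne_zero
  have hB : (∏ j ∈ Finset.Icc 1 n,
        bAmp (n + 2) (twoPiI * (x + 1 / 2 - j / (n + 2 : ℕ)))) *
        aAmp (n + 2) (twoPiI * (x - 1 / 2 + e)) =
      (-1 : ℂ) ^ (n + 1) * bAmp (n + 2) (twoPiI * (1 / 2 - x)) := by
    apply mul_right_cancel₀ (mul_ne_zero g₂ g₅)
    have hAw : aAmp (n + 2) (twoPiI * (x - 1 / 2 + e)) *
        (Gamma (x - 1 / 2 + e) * Gamma (3 / 2 - 2 * e - x)) * (x - 1 / 2 + e) =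
        -(Gamma (3 / 2 - e - x) * ((x - 1 / 2) * Gamma (x - 1 / 2))) := by
      have e₂ : 1 - e - (x - 1 / 2 + e) = 3 / 2 - 2 * e - x := by ring
      rw [← he, e₂] at g₄
      rw [aAmp_twoPiI_mul, ← he, e₂, G₃, ← G₂,
        show 1 - (x - 1 / 2 + e) = 3 / 2 - e - x by ring,
        show 1 - e + (x - 1 / 2 + e) = 1 / 2 + x by ring,
        div_mul_eq_mul_div, div_mul_eq_mul_div, div_eq_iff (mul_ne_zero (mul_ne_zero hw g₆) g₄)]
      ring
    rw [show 1 - (x + 1 / 2) = 1 / 2 - x by ring,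
      show x + 1 / 2 - (1 - e) = x - 1 / 2 + e by ring,
      show 1 - (x + 1 / 2 - (1 - 2 * e)) = 3 / 2 - 2 * e - x by ring] at P₂
    apply mul_right_cancel₀ hw
    have hBA : bAmp (n + 2) (twoPiI * (1 / 2 - x)) * (x - 1 / 2 + e) =
        aAmp (n + 2) (twoPiI * (1 / 2 - x)) * (x - 1 / 2) := by
      rw [bAmp_twoPiI_mul, ← he, div_mul_eq_mul_div, div_eq_iff hw']
      ring
    linear_combination aAmp (n + 2) (twoPiI * (x - 1 / 2 + e)) * (x - 1 / 2 + e) * P₂ +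
      (-1) ^ n * hAw
      - (-1) ^ (n + 1) * (Gamma (x + 1 / 2 - e) * Gamma (1 / 2 - x)) * hBA
      - (-1) ^ (n + 1) * (x - 1 / 2) * hA
  refine ⟨?_, hB, ?_⟩
  · apply mul_right_cancel₀ (mul_ne_zero g₂ g₅)
    rw [show 1 - (x + 1 / 2) = 1 / 2 - x by ring, show x + 1 / 2 - 1 = x - 1 / 2 by ring,
      show 1 - (x + 1 / 2 - (1 - e)) = 3 / 2 - e - x by ring] at P₁
    rw [mul_assoc _ (aAmp _ _), hA]
    exact P₁
  · rw [cAmp_twoPiI_mul, cAmp_twoPiI_mul, ← he, add_sub_cancel_right]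
    rw [bAmp_twoPiI_mul, ← he] at hB
    have hq : (1 / 2 - x) / (x - 1 / 2) = -1 := by
      rw [div_eq_iff hx]
      ring
    linear_combination e / (x - 1 / 2) * hB +
      (-1) ^ (n + 1) * aAmp (n + 2) (twoPiI * (1 / 2 - x)) * e / (1 / 2 - x - e) * hq
end
end

section
/- Fused three-particle identity for SU(3): on (ℂ³)^{⊗3} one has the operator identity (id − P_{12}) ∘ (2·id − P_{13}) ∘ (id − P_{23}) = 2·E, where E is the rank-one operator whose matrix entries in the standard basis are E^{(β1,β2,β3)}_{(α1,α2,α3)} = ε_{β1β2β3}·ε_{α1α2α3}, ε being the totally antisymmetric Levi-Civita symbol on three indices with ε_{123} = 1. -/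
open Matrix

noncomputable section

open Classical in
/-- The totally antisymmetric Levi-Civita symbol: the sign of `f` if `f` is a
permutation, and `0` otherwise (i.e. if two indices coincide). -/
def levi {n : ℕ} (f : Fin n → Fin n) : ℤ :=
  if h : Function.Bijective f then ((Equiv.Perm.sign (Equiv.ofBijective f h) : ℤˣ) : ℤ) else 0

/-- The permutation operator on factors 1 and 2 of (ℂ³)^{⊗3}. -/
def P12 : Matrix (Fin 3 × Fin 3 × Fin 3) (Fin 3 × Fin 3 × Fin 3) ℂ :=
  fun p q => if p.1 = q.2.1 ∧ p.2.1 = q.1 ∧ p.2.2 = q.2.2 then 1 else 0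

/-- The permutation operator on factors 1 and 3 of (ℂ³)^{⊗3}. -/
def P13 : Matrix (Fin 3 × Fin 3 × Fin 3) (Fin 3 × Fin 3 × Fin 3) ℂ :=
  fun p q => if p.1 = q.2.2 ∧ p.2.2 = q.1 ∧ p.2.1 = q.2.1 then 1 else 0

/-- The permutation operator on factors 2 and 3 of (ℂ³)^{⊗3}. -/
def P23 : Matrix (Fin 3 × Fin 3 × Fin 3) (Fin 3 × Fin 3 × Fin 3) ℂ :=
  fun p q => if p.2.1 = q.2.2 ∧ p.2.2 = q.2.1 ∧ p.1 = q.1 then 1 else 0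

/-- The rank-one operator E with entries E^{(β1,β2,β3)}_{(α1,α2,α3)} = ε_{β1β2β3}·ε_{α1α2α3}. -/
def Eop : Matrix (Fin 3 × Fin 3 × Fin 3) (Fin 3 × Fin 3 × Fin 3) ℂ :=
  fun p q => ((levi ![p.1, p.2.1, p.2.2] : ℤ) : ℂ) * ((levi ![q.1, q.2.1, q.2.2] : ℤ) : ℂ)

/-- The Levi-Civita symbol of `f` is the determinant of the 0-1 matrix whose `i`-th row is the
standard basis vector indexed by `f i`. -/
theorem levi_eq_det {n : ℕ} (f : Fin n → Fin n) :
    ((levi f : ℤ) : ℂ) = ((1 : Matrix (Fin n) (Fin n) ℂ).submatrix f id).det := by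
  unfold levi
  split_ifs with h
  · have := Matrix.det_permute (Equiv.ofBijective f h) (1 : Matrix (Fin n) (Fin n) ℂ)
    rw [Matrix.det_one, mul_one] at this
    exact this.symm
  · rw [← Finite.injective_iff_bijective, Function.Injective] at h
    push Not at h
    obtain ⟨i, j, hij, hne⟩ := h
    rw [Matrix.det_zero_of_row_eq hne, Int.cast_zero]
    ext k
    rw [Matrix.submatrix_apply, Matrix.submatrix_apply, hij]

/-- A product of two Levi-Civita symbols is a determinant of Kronecker deltas. -/
theorem levi_mul_levi {n : ℕ} (f g : Fin n → Fin n) :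
    ((levi f : ℤ) : ℂ) * ((levi g : ℤ) : ℂ) =
      ((1 : Matrix (Fin n) (Fin n) ℂ).submatrix f g).det := by
  rw [levi_eq_det, levi_eq_det, ← Matrix.det_transpose (Matrix.submatrix _ g id),
    ← Matrix.det_mul, Matrix.transpose_submatrix, Matrix.transpose_one,
    ← Matrix.submatrix_mul _ _ f id g Function.bijective_id, Matrix.one_mul]

theorem P12_mul_apply (M : Matrix (Fin 3 × Fin 3 × Fin 3) (Fin 3 × Fin 3 × Fin 3) ℂ)
    (p q : Fin 3 × Fin 3 × Fin 3) : (P12 * M) p q = M (p.2.1, p.1, p.2.2) q := by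
  rw [Matrix.mul_apply, Finset.sum_eq_single (p.2.1, p.1, p.2.2)]
  · simp [P12]
  · rintro ⟨a, b, c⟩ - hne
    rw [P12, if_neg, zero_mul]
    rintro ⟨h₁, h₂, h₃⟩
    exact hne (by simp_all)
  · simp

theorem mul_P23_apply (M : Matrix (Fin 3 × Fin 3 × Fin 3) (Fin 3 × Fin 3 × Fin 3) ℂ)
    (p q : Fin 3 × Fin 3 × Fin 3) : (M * P23) p q = M p (q.1, q.2.2, q.2.1) := by
  rw [Matrix.mul_apply, Finset.sum_eq_single (q.1, q.2.2, q.2.1)]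
  · simp [P23]
  · rintro ⟨a, b, c⟩ - hne
    rw [P23, if_neg, mul_zero]
    rintro ⟨h₁, h₂, h₃⟩
    exact hne (by simp_all)
  · simp

theorem ite_eq_and_eq_and_eq {α β γ : Type*} [DecidableEq α] [DecidableEq β] [DecidableEq γ]
    (a d : α) (b e : β) (c f : γ) [Decidable (a = d ∧ b = e ∧ c = f)] :
    (if a = d ∧ b = e ∧ c = f then (1 : ℂ) else 0) =
      (1 : Matrix α α ℂ) a d * (1 : Matrix β β ℂ) b e * (1 : Matrix γ γ ℂ) c f := by
  simp only [Matrix.one_apply]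
  split_ifs <;> simp_all

theorem one_apply_triple {α β γ : Type*} [DecidableEq α] [DecidableEq β] [DecidableEq γ]
    (a d : α) (b e : β) (c f : γ) :
    (1 : Matrix (α × β × γ) (α × β × γ) ℂ) (a, b, c) (d, e, f) =
      (1 : Matrix α α ℂ) a d * (1 : Matrix β β ℂ) b e * (1 : Matrix γ γ ℂ) c f := by
  simp only [Matrix.one_apply, Prod.mk.injEq]
  split_ifs <;> simp_all

theorem Eop_apply (a b c d e f : Fin 3) :
    letI δ : Matrix (Fin 3) (Fin 3) ℂ := 1
    Eop (a, b, c) (d, e, f) =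
      δ a d * δ b e * δ c f - δ a d * δ b f * δ c e - δ a e * δ b d * δ c f +
        δ a e * δ b f * δ c d + δ a f * δ b d * δ c e - δ a f * δ b e * δ c d := by
  rw [Eop, levi_mul_levi, Matrix.det_fin_three]
  rfl

/-- Fused three-particle identity for SU(3):
(id − P₁₂)(2·id − P₁₃)(id − P₂₃) = 2·E. -/
theorem fused_three_particle_SU3 :
    ((1 : Matrix (Fin 3 × Fin 3 × Fin 3) (Fin 3 × Fin 3 × Fin 3) ℂ) - P12) *
        ((2 : ℂ) • (1 : Matrix (Fin 3 × Fin 3 × Fin 3) (Fin 3 × Fin 3 × Fin 3) ℂ) - P13) *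
        ((1 : Matrix (Fin 3 × Fin 3 × Fin 3) (Fin 3 × Fin 3 × Fin 3) ℂ) - P23) =
      (2 : ℂ) • Eop := by
  ext ⟨a, b, c⟩ ⟨d, e, f⟩
  simp only [sub_mul, mul_sub, one_mul, mul_one, Matrix.sub_apply, P12_mul_apply, mul_P23_apply,
    Matrix.smul_apply, smul_eq_mul, Eop_apply, one_apply_triple, P13, ite_eq_and_eq_and_eq]
  ring
end
end

section
/- Highest-weight vector lemma: let v : (Fin n → {1,…,N}) → ℂ be the component function of a vector in (ℂ^N)^{⊗n}, and define the lowering operator E by (Ev)(β) := Σ_{i : β_i < N} v(β with its i-th entry replaced by β_i + 1). If Ev = 0 and v(α) = 0 for every index tuple α with α_1 = 1, then v = 0. -/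
/-- Highest-weight vector lemma: if v (the component function of a vector in
(ℂ^N)^{⊗n}, indexed by tuples in {1,…,N} represented 0-based by `Fin N`) is
annihilated by the lowering operator E, and all components with first index 1
(i.e. `0 : Fin N`) vanish, then v = 0. -/
theorem highest_weight_vector_lemma (n N : ℕ) (hn : 1 ≤ n) (hN : 1 ≤ N)
    (v : (Fin n → Fin N) → ℂ)
    (hE : ∀ β : Fin n → Fin N,
      (∑ i : Fin n, if h : (β i : ℕ) + 1 < N then
        v (Function.update β i ⟨(β i : ℕ) + 1, h⟩) else 0) = 0)
    (h1 : ∀ α : Fin n → Fin N, α ⟨0, hn⟩ = ⟨0, hN⟩ → v α = 0) :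
    v = 0 := by
  have key : ∀ k : ℕ, ∀ α : Fin n → Fin N, (α ⟨0, hn⟩ : ℕ) = k → v α = 0 := by
    intro k
    induction k with
    | zero => exact fun α hα => h1 α (Fin.ext hα)
    | succ k ih =>
      intro α hα
      have hk : k + 1 < N := hα ▸ (α ⟨0, hn⟩).isLt
      have hβ := hE (Function.update α ⟨0, hn⟩ ⟨k, by omega⟩)
      rw [Finset.sum_eq_single ⟨0, hn⟩] at hβ
      · have hα' : (⟨k + 1, hk⟩ : Fin N) = α ⟨0, hn⟩ := Fin.ext hα.symm
        simpa [hk, hα'] using hβ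
      · intro i _ hi
        split_ifs with h
        · exact ih _ (by simp [Function.update_of_ne hi.symm])
        · rfl
      · simp
  exact funext fun α => key _ α rfl
end

section
/- Yang–Baxter algebra (RTT relation) for the monodromy matrix: for all θ = (θ1,…,θn) ∈ ℂⁿ and z_a, z_b ∈ ℂ such that θ_i − z_a ≠ iη and θ_i − z_b ≠ iη for all i and z_a − z_b ≠ iη, the operators on (ℂ^N)^{⊗n} ⊗ ℂ^N ⊗ ℂ^N satisfy T_a(θ, z_a) ∘ T_b(θ, z_b) ∘ S̃_{ab}(z_a − z_b) = S̃_{ab}(z_a − z_b) ∘ T_b(θ, z_b) ∘ T_a(θ, z_a), where T_a(θ, z) := S̃_{1,a}(θ1 − z)∘⋯∘S̃_{n,a}(θn − z) acts on the quantum factors and the factor a (the (n+1)-st), T_b(θ, z) acts analogously on the quantum factors and the factor b (the (n+2)-nd), and S̃_{ab} acts on the two last factors. -/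
open Complex Matrix

noncomputable section

/-- S̃ acting on the i-th quantum factor and the auxiliary factor a
(the (n+1)-st factor) of (ℂ^N)^{⊗n} ⊗ ℂ^N ⊗ ℂ^N. -/
def SqA (n N : ℕ) (i : Fin n) (θ : ℂ) :
    Matrix ((Fin n → Fin N) × Fin N × Fin N) ((Fin n → Fin N) × Fin N × Fin N) ℂ :=
  fun p q => Stilde N θ (p.1 i, p.2.1) (q.1 i, q.2.1) *
    (if (∀ j, j ≠ i → p.1 j = q.1 j) ∧ p.2.2 = q.2.2 then 1 else 0)

/-- S̃ acting on the i-th quantum factor and the auxiliary factor b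
(the (n+2)-nd factor) of (ℂ^N)^{⊗n} ⊗ ℂ^N ⊗ ℂ^N. -/
def SqB (n N : ℕ) (i : Fin n) (θ : ℂ) :
    Matrix ((Fin n → Fin N) × Fin N × Fin N) ((Fin n → Fin N) × Fin N × Fin N) ℂ :=
  fun p q => Stilde N θ (p.1 i, p.2.2) (q.1 i, q.2.2) *
    (if (∀ j, j ≠ i → p.1 j = q.1 j) ∧ p.2.1 = q.2.1 then 1 else 0)

/-- S̃ acting on the two auxiliary factors a and b. -/
def Sab (n N : ℕ) (θ : ℂ) :
    Matrix ((Fin n → Fin N) × Fin N × Fin N) ((Fin n → Fin N) × Fin N × Fin N) ℂ :=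
  fun p q => Stilde N θ (p.2.1, p.2.2) (q.2.1, q.2.2) * (if p.1 = q.1 then 1 else 0)

/-- The monodromy matrix T_a(θ, z) = S̃_{1,a}(θ1 − z)∘⋯∘S̃_{n,a}(θn − z). -/
def Ta (n N : ℕ) (θ : Fin n → ℂ) (z : ℂ) :
    Matrix ((Fin n → Fin N) × Fin N × Fin N) ((Fin n → Fin N) × Fin N × Fin N) ℂ :=
  ((List.finRange n).map fun i => SqA n N i (θ i - z)).prod

/-- The monodromy matrix T_b(θ, z) = S̃_{1,b}(θ1 − z)∘⋯∘S̃_{n,b}(θn − z). -/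
def Tb (n N : ℕ) (θ : Fin n → ℂ) (z : ℂ) :
    Matrix ((Fin n → Fin N) × Fin N × Fin N) ((Fin n → Fin N) × Fin N × Fin N) ℂ :=
  ((List.finRange n).map fun i => SqB n N i (θ i - z)).prod

/-- The 0-1 matrix of a self-map of the index set. -/
def mapMatrix {α : Type*} [DecidableEq α] (f : α → α) : Matrix α α ℂ :=
  fun p q => if f p = q then 1 else 0

lemma mapMatrix_mul {α : Type*} [DecidableEq α] [Fintype α] (f g : α → α) :
    mapMatrix f * mapMatrix g = mapMatrix (g ∘ f) := by
  ext p q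
  simp only [mapMatrix, Matrix.mul_apply, ite_mul, one_mul, zero_mul, Finset.sum_ite_eq,
    Finset.mem_univ, if_true, Function.comp_apply]

/-- Exchange of the `i`-th quantum index with the auxiliary index `a`. -/
def swapA (n N : ℕ) (i : Fin n) (p : (Fin n → Fin N) × Fin N × Fin N) :
    (Fin n → Fin N) × Fin N × Fin N :=
  (Function.update p.1 i p.2.1, p.1 i, p.2.2)

/-- Exchange of the `i`-th quantum index with the auxiliary index `b`. -/
def swapB (n N : ℕ) (i : Fin n) (p : (Fin n → Fin N) × Fin N × Fin N) :
    (Fin n → Fin N) × Fin N × Fin N :=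
  (Function.update p.1 i p.2.2, p.2.1, p.1 i)

/-- Exchange of the two auxiliary indices. -/
def swapAB (n N : ℕ) (p : (Fin n → Fin N) × Fin N × Fin N) :
    (Fin n → Fin N) × Fin N × Fin N :=
  (p.1, p.2.2, p.2.1)

lemma Stilde_apply (N : ℕ) (θ : ℂ) (a b c d : Fin N) :
    Stilde N θ (a, b) (c, d) = (θ - Complex.I * etaC N)⁻¹ *
      (θ * (if a = c ∧ b = d then 1 else 0) -
        Complex.I * etaC N * (if a = d ∧ b = c then 1 else 0)) := by
  simp [Stilde, permOp, Matrix.one_apply]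

lemma update_eq_iff_forall_ne {ι α : Type*} [DecidableEq ι] (f g : ι → α) (i : ι) (a : α) :
    Function.update f i a = g ↔ a = g i ∧ ∀ j, j ≠ i → f j = g j :=
  Function.update_eq_iff

lemma eq_iff_forall_ne {ι α : Type*} (f g : ι → α) (i : ι) :
    f = g ↔ f i = g i ∧ ∀ j, j ≠ i → f j = g j := by
  classical
  rw [← update_eq_iff_forall_ne, Function.update_eq_self]

lemma SqA_eq (n N : ℕ) (i : Fin n) (θ : ℂ) :
    SqA n N i θ = (θ - Complex.I * etaC N)⁻¹ •
      (θ • 1 - (Complex.I * etaC N) • mapMatrix (swapA n N i)) := by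
  ext ⟨p, a, b⟩ ⟨q, c, d⟩
  simp only [SqA, Stilde_apply, mapMatrix, swapA, Matrix.smul_apply, Matrix.sub_apply,
    Matrix.one_apply, smul_eq_mul, Prod.mk.injEq, update_eq_iff_forall_ne,
    eq_iff_forall_ne p q i]
  split_ifs <;> first | ring1 | (exfalso; tauto)

lemma SqB_eq (n N : ℕ) (i : Fin n) (θ : ℂ) :
    SqB n N i θ = (θ - Complex.I * etaC N)⁻¹ •
      (θ • 1 - (Complex.I * etaC N) • mapMatrix (swapB n N i)) := by
  ext ⟨p, a, b⟩ ⟨q, c, d⟩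
  simp only [SqB, Stilde_apply, mapMatrix, swapB, Matrix.smul_apply, Matrix.sub_apply,
    Matrix.one_apply, smul_eq_mul, Prod.mk.injEq, update_eq_iff_forall_ne,
    eq_iff_forall_ne p q i]
  split_ifs <;> first | ring1 | (exfalso; tauto)

lemma Sab_eq (n N : ℕ) (θ : ℂ) :
    Sab n N θ = (θ - Complex.I * etaC N)⁻¹ •
      (θ • 1 - (Complex.I * etaC N) • mapMatrix (swapAB n N)) := by
  ext ⟨p, a, b⟩ ⟨q, c, d⟩
  simp only [Sab, Stilde_apply, mapMatrix, swapAB, Matrix.smul_apply, Matrix.sub_apply,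
    Matrix.one_apply, smul_eq_mul, Prod.mk.injEq]
  split_ifs <;> first | ring1 | (exfalso; tauto)

/-- The Yang–Baxter equation for rational R-matrices built from elements multiplying like the
three transpositions of three letters. -/
lemma yangBaxter_of_transpositions {R : Type*} [Ring R] [Algebra ℂ R] {A B C : R}
    (hBC : B * C = A * B) (hCA : C * A = A * B) (hCB : C * B = B * A) (hAC : A * C = B * A)
    (hABC : A * B * C = C * B * A) (u v c k₁ k₂ k₃ : ℂ) :
    k₁ • (u • 1 - c • A) * k₂ • ((u + v) • 1 - c • B) * k₃ • (v • 1 - c • C) =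
      k₃ • (v • 1 - c • C) * k₂ • ((u + v) • 1 - c • B) * k₁ • (u • 1 - c • A) := by
  simp only [smul_mul_assoc, mul_smul_comm, sub_mul, mul_sub, one_mul, mul_one, smul_sub,
    smul_smul, hABC, hBC, hCA, hCB, hAC]
  module

lemma SqA_SqB_Sab (n N : ℕ) (i : Fin n) (t za zb : ℂ) :
    SqA n N i (t - za) * SqB n N i (t - zb) * Sab n N (za - zb) =
      Sab n N (za - zb) * SqB n N i (t - zb) * SqA n N i (t - za) := by
  have h : t - zb = (t - za) + (za - zb) := by ring
  rw [SqA_eq, SqB_eq, Sab_eq, h]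
  apply yangBaxter_of_transpositions <;> simp only [mapMatrix_mul] <;> congr 1 <;>
    ext ⟨p, a, b⟩ : 1 <;> simp [swapA, swapB, swapAB]

lemma commute_SqA_SqB (n N : ℕ) {i j : Fin n} (hij : i ≠ j) (s t : ℂ) :
    Commute (SqA n N i s) (SqB n N j t) := by
  have h : Commute (mapMatrix (swapA n N i)) (mapMatrix (swapB n N j)) := by
    simp only [Commute, SemiconjBy, mapMatrix_mul]
    congr 1
    ext ⟨p, a, b⟩ : 1
    simp [swapA, swapB, hij, hij.symm, Function.update_comm hij]
  rw [SqA_eq, SqB_eq]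
  refine Commute.smul_left (Commute.smul_right ?_ _) _
  refine Commute.sub_left ((Commute.one_left _).smul_left _) (Commute.smul_left ?_ _)
  exact Commute.sub_right ((Commute.one_right _).smul_right _) (h.smul_right _)

/-- Local exchange relations with `R` pass to ordered products. -/
lemma prod_mul_prod_mul_eq {ι M : Type*} [Monoid M] (A B : ι → M) (R : M)
    (hR : ∀ i, A i * B i * R = R * B i * A i)
    (hAB : ∀ i j, i ≠ j → Commute (A i) (B j)) (l : List ι) (hl : l.Nodup) :
    (l.map A).prod * (l.map B).prod * R = R * (l.map B).prod * (l.map A).prod := by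
  induction l with
  | nil => simp
  | cons i l ih =>
    obtain ⟨hi, hl⟩ := List.nodup_cons.mp hl
    have h₁ : Commute (l.map A).prod (B i) := by
      refine Commute.list_prod_left _ _ fun x hx => ?_
      obtain ⟨j, hj, rfl⟩ := List.mem_map.mp hx
      exact hAB j i (ne_of_mem_of_not_mem hj hi)
    have h₂ : Commute (A i) (l.map B).prod := by
      refine Commute.list_prod_right _ _ fun x hx => ?_
      obtain ⟨j, hj, rfl⟩ := List.mem_map.mp hx
      exact hAB i j (ne_of_mem_of_not_mem hj hi).symm
    simp only [List.map_cons, List.prod_cons]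
    calc A i * (l.map A).prod * (B i * (l.map B).prod) * R
        = A i * ((l.map A).prod * B i) * (l.map B).prod * R := by simp only [mul_assoc]
      _ = A i * B i * ((l.map A).prod * (l.map B).prod * R) := by
          rw [h₁.eq]; simp only [mul_assoc]
      _ = A i * B i * R * ((l.map B).prod * (l.map A).prod) := by
          rw [ih hl]; simp only [mul_assoc]
      _ = R * B i * (A i * (l.map B).prod) * (l.map A).prod := by
          rw [hR]; simp only [mul_assoc]
      _ = R * (B i * (l.map B).prod) * (A i * (l.map A).prod) := by
          rw [h₂.eq]; simp only [mul_assoc]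

/-- Yang–Baxter algebra (RTT relation) for the monodromy matrix. -/
theorem RTT_relation (n N : ℕ) (hn : 1 ≤ n) (hN : 2 ≤ N)
    (θ : Fin n → ℂ) (za zb : ℂ)
    (ha : ∀ i, θ i - za ≠ Complex.I * etaC N)
    (hb : ∀ i, θ i - zb ≠ Complex.I * etaC N)
    (hab : za - zb ≠ Complex.I * etaC N) :
    Ta n N θ za * Tb n N θ zb * Sab n N (za - zb) =
      Sab n N (za - zb) * Tb n N θ zb * Ta n N θ za := by
  exact prod_mul_prod_mul_eq _ _ _ (fun i => SqA_SqB_Sab n N i (θ i) za zb)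
    (fun i j hij => commute_SqA_SqB n N hij _ _) _ (List.nodup_finRange n)
end
end

section
/- Algebraic Bethe ansatz commutation relation (C–A): for all θ = (θ1,…,θn) ∈ ℂⁿ and z, w ∈ ℂ with θ_i − z ≠ iη and θ_i − w ≠ iη for all i, w − z ≠ iη, w ≠ z, and for every β ∈ {2,…,N}, one has the identity in End((ℂ^N)^{⊗n}): C̃^β(θ,z) ∘ Ã(θ,w) = (1/b̃(w−z))·Ã(θ,w) ∘ C̃^β(θ,z) − (c̃(w−z)/b̃(w−z))·Ã(θ,z) ∘ C̃^β(θ,w). -/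
open Complex Matrix

noncomputable section

/-- The amplitude b̃(θ) = θ/(θ − iη). -/
def btilde (N : ℕ) (θ : ℂ) : ℂ := θ / (θ - Complex.I * etaC N)

/-- The amplitude c̃(θ) = −iη/(θ − iη). -/
def ctilde (N : ℕ) (θ : ℂ) : ℂ := -(Complex.I * etaC N) / (θ - Complex.I * etaC N)

/-- S̃ acting on the i-th quantum factor and the auxiliary (last) factor of
(ℂ^N)^{⊗n} ⊗ ℂ^N. -/
def Sq (n N : ℕ) (i : Fin n) (θ : ℂ) :
    Matrix ((Fin n → Fin N) × Fin N) ((Fin n → Fin N) × Fin N) ℂ :=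
  fun p q => Stilde N θ (p.1 i, p.2) (q.1 i, q.2) *
    (if ∀ j, j ≠ i → p.1 j = q.1 j then 1 else 0)

/-- The monodromy matrix T(θ,z) = S̃_{1,0}(θ1 − z)∘⋯∘S̃_{n,0}(θn − z). -/
def monodromy (n N : ℕ) (θ : Fin n → ℂ) (z : ℂ) :
    Matrix ((Fin n → Fin N) × Fin N) ((Fin n → Fin N) × Fin N) ℂ :=
  ((List.finRange n).map fun i => Sq n N i (θ i - z)).prod

/-- The auxiliary-space component T(θ,z)^{β'}_β = (id ⊗ e_{β'}^*) ∘ T(θ,z) ∘ (id ⊗ e_β),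
an operator on (ℂ^N)^{⊗n}. -/
def Tcomp (n N : ℕ) (θ : Fin n → ℂ) (z : ℂ) (β' β : Fin N) :
    Matrix (Fin n → Fin N) (Fin n → Fin N) ℂ :=
  fun α α' => monodromy n N θ z (α, β') (α', β)

/-- Ã(θ,z) = T(θ,z)^1_1 (auxiliary index 1 of the paper is `0 : Fin N`). -/
def Atilde (n N : ℕ) [NeZero N] (θ : Fin n → ℂ) (z : ℂ) :
    Matrix (Fin n → Fin N) (Fin n → Fin N) ℂ :=
  Tcomp n N θ z 0 0

/-- C̃^β(θ,z) = T(θ,z)^β_1. -/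
def Ctilde (n N : ℕ) [NeZero N] (θ : Fin n → ℂ) (z : ℂ) (β : Fin N) :
    Matrix (Fin n → Fin N) (Fin n → Fin N) ℂ :=
  Tcomp n N θ z β 0

/-- The exchange relation `X₁ Y₂ R₁₂(v) = R₁₂(v) Y₂ X₁` with `R(v) = v - k P`, written in
components, for matrices `X`, `Y` with entries in an algebra. -/
def ExchangeRel {A ι : Type*} [Ring A] [Algebra ℂ A] (v k : ℂ) (X Y : ι → ι → A) : Prop :=
  ∀ a b c d, v • (X a b * Y c d) - k • (X a d * Y c b) =
    v • (Y c d * X a b) - k • (Y a d * X c b)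

theorem ExchangeRel.mul {A ι : Type*} [Ring A] [Algebra ℂ A] [Fintype ι] {v k : ℂ}
    {X₁ X₂ Y₁ Y₂ : ι → ι → A} (h₁ : ExchangeRel v k X₁ Y₁) (h₂ : ExchangeRel v k X₂ Y₂)
    (hXY : ∀ a b c d, Commute (X₂ a b) (Y₁ c d)) (hYX : ∀ a b c d, Commute (Y₂ a b) (X₁ c d)) :
    ExchangeRel v k (fun a b => ∑ c, X₁ a c * X₂ c b) (fun a b => ∑ c, Y₁ a c * Y₂ c b) := by
  intro a b c d
  have expand : ∀ (U₁ U₂ V₁ V₂ : ι → ι → A), (∀ a b c d, Commute (U₂ a b) (V₁ c d)) →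
      ∀ a b c d, (∑ e, U₁ a e * U₂ e b) * (∑ f, V₁ c f * V₂ f d) =
        ∑ e, ∑ f, U₁ a e * V₁ c f * (U₂ e b * V₂ f d) := by
    intro U₁ U₂ V₁ V₂ h a b c d
    rw [Finset.sum_mul_sum]
    refine Finset.sum_congr rfl fun e _ => Finset.sum_congr rfl fun f _ => ?_
    rw [mul_assoc, ← mul_assoc (U₂ e b), (h e b c f).eq]
    simp only [mul_assoc]
  simp only [expand X₁ X₂ Y₁ Y₂ hXY, expand Y₁ Y₂ X₁ X₂ hYX]
  calc
    _ = ∑ e, ∑ f, X₁ a e * Y₁ c f * (v • (X₂ e b * Y₂ f d) - k • (X₂ e d * Y₂ f b)) := by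
      simp only [mul_sub, mul_smul_comm, Finset.sum_sub_distrib, Finset.smul_sum]
    _ = ∑ e, ∑ f, X₁ a e * Y₁ c f * (v • (Y₂ f d * X₂ e b) - k • (Y₂ e d * X₂ f b)) := by
      simp only [h₂ _ _ _ _]
    _ = ∑ e, ∑ f, (v • (X₁ a e * Y₁ c f) - k • (X₁ a f * Y₁ c e)) * (Y₂ f d * X₂ e b) := by
      simp only [mul_sub, sub_mul, mul_smul_comm, smul_mul_assoc, Finset.sum_sub_distrib]
      congr 1
      exact Finset.sum_comm
    _ = ∑ e, ∑ f, (v • (Y₁ c f * X₁ a e) - k • (Y₁ a f * X₁ c e)) * (Y₂ f d * X₂ e b) := by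
      simp only [h₁ _ _ _ _]
    _ = _ := by
      simp only [sub_mul, smul_mul_assoc, Finset.sum_sub_distrib, Finset.smul_sum]
      congr 1 <;> exact Finset.sum_comm

/-- The component of an operator on quantum space ⊗ auxiliary space with given auxiliary indices. -/
def auxBlock {Q ι : Type*} (M : Matrix (Q × ι) (Q × ι) ℂ) (a b : ι) : Matrix Q Q ℂ :=
  fun α α' => M (α, a) (α', b)

theorem auxBlock_one {Q ι : Type*} [DecidableEq Q] [DecidableEq ι] (a b : ι) :
    auxBlock (1 : Matrix (Q × ι) (Q × ι) ℂ) a b = (if a = b then 1 else 0 : ℂ) • 1 := by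
  ext α α'
  by_cases h : α = α' <;> by_cases h' : a = b <;> simp [auxBlock, Matrix.one_apply, h, h']

theorem auxBlock_mul {Q ι : Type*} [Fintype Q] [Fintype ι] (M M' : Matrix (Q × ι) (Q × ι) ℂ) :
    auxBlock (M * M') = fun a b => ∑ c, auxBlock M a c * auxBlock M' c b := by
  ext a b α α'
  simp only [auxBlock, Matrix.mul_apply, Matrix.sum_apply, Fintype.sum_prod_type]
  exact Finset.sum_comm

/-- The matrix unit `|a⟩⟨b|` acting on the `i`-th tensor factor. -/
def siteUnit {n N : ℕ} (i : Fin n) (a b : Fin N) : Matrix (Fin n → Fin N) (Fin n → Fin N) ℂ :=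
  fun α α' => if α i = a ∧ α' = Function.update α i b then 1 else 0

theorem siteUnit_mul_apply {n N : ℕ} (i : Fin n) (a b : Fin N)
    (M : Matrix (Fin n → Fin N) (Fin n → Fin N) ℂ) (α α' : Fin n → Fin N) :
    (siteUnit i a b * M) α α' = if α i = a then M (Function.update α i b) α' else 0 := by
  simp [Matrix.mul_apply, siteUnit, ite_and]

theorem siteUnit_mul_siteUnit {n N : ℕ} (i : Fin n) (a b c d : Fin N) :
    siteUnit i a b * siteUnit i c d = (if b = c then 1 else 0 : ℂ) • siteUnit i a d := by
  ext α α'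
  rw [siteUnit_mul_apply]
  by_cases h : α i = a <;> by_cases h' : b = c <;> simp [siteUnit, h, h']

theorem siteUnit_commute {n N : ℕ} {i j : Fin n} (hij : i ≠ j) (a b c d : Fin N) :
    Commute (siteUnit i a b) (siteUnit j c d) := by
  ext α α'
  rw [siteUnit_mul_apply, siteUnit_mul_apply]
  simp only [siteUnit, Function.update_of_ne hij, Function.update_of_ne hij.symm,
    Function.update_comm hij b d α]
  by_cases h : α i = a <;> by_cases h' : α j = c <;> simp [h, h']

theorem auxBlock_Sq (n N : ℕ) (i : Fin n) (u : ℂ) (a b : Fin N) :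
    auxBlock (Sq n N i u) a b = (u - Complex.I * etaC N)⁻¹ •
      (u • (if a = b then 1 else 0 : ℂ) • 1 - (Complex.I * etaC N) • siteUnit i b a) := by
  ext α α'
  have h_one : (α = α') ↔ (α i = α' i ∧ ∀ j, j ≠ i → α j = α' j) := by
    refine ⟨by rintro rfl; simp, fun h => funext fun j => ?_⟩
    by_cases hj : j = i
    · exact hj ▸ h.1
    · exact h.2 j hj
  have h_unit : (α i = b ∧ α' = Function.update α i a) ↔
      ((α i = b ∧ a = α' i) ∧ ∀ j, j ≠ i → α j = α' j) := by
    rw [Function.eq_update_iff]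
    simp only [eq_comm (a := a), and_assoc, eq_comm (a := α _)]
  simp only [auxBlock, Sq, Stilde, permOp, siteUnit, Matrix.smul_apply, Matrix.sub_apply,
    Matrix.one_apply, smul_eq_mul, h_one, h_unit, Prod.mk.injEq]
  by_cases h : ∀ j, j ≠ i → α j = α' j
  · simp only [if_pos h, and_iff_left h]
    by_cases hab : a = b <;> simp [hab]
  · simp only [h, and_false]
    simp

theorem auxBlock_Sq_commute {n N : ℕ} {i j : Fin n} (hij : i ≠ j) (u u' : ℂ) (a b c d : Fin N) :
    Commute (auxBlock (Sq n N i u) a b) (auxBlock (Sq n N j u') c d) := by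
  have scalar_left : ∀ (r : ℂ) (M : Matrix (Fin n → Fin N) (Fin n → Fin N) ℂ),
      Commute (r • (1 : Matrix (Fin n → Fin N) (Fin n → Fin N) ℂ)) M :=
    fun r M => (Commute.one_left M).smul_left r
  simp only [auxBlock_Sq]
  refine Commute.smul_left (Commute.smul_right ?_ _) _
  refine Commute.sub_left ((scalar_left _ _).smul_left _) (Commute.smul_left ?_ _)
  exact Commute.sub_right ((scalar_left _ _).symm.smul_right _)
    ((siteUnit_commute hij _ _ _ _).smul_right _)

theorem auxBlock_prod_Sq_commute {n N : ℕ} {i : Fin n} (u : ℂ) (f : Fin n → ℂ)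
    (l : List (Fin n)) (hi : i ∉ l) (a b c d : Fin N) :
    Commute (auxBlock (l.map fun j => Sq n N j (f j)).prod a b) (auxBlock (Sq n N i u) c d) := by
  induction l generalizing a b with
  | nil =>
    simp only [List.map_nil, List.prod_nil, auxBlock_one]
    exact (Commute.one_left _).smul_left _
  | cons j l ih =>
    rw [List.mem_cons, not_or] at hi
    simp only [List.map_cons, List.prod_cons, auxBlock_mul]
    exact Commute.sum_left _ _ _ fun e _ =>
      (auxBlock_Sq_commute (Ne.symm hi.1) _ _ _ _ _ _).mul_left (ih hi.2 _ _)

theorem exchangeRel_Sq (n N : ℕ) (i : Fin n) (u u' : ℂ) :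
    ExchangeRel (u' - u) (Complex.I * etaC N)
      (auxBlock (Sq n N i u)) (auxBlock (Sq n N i u')) := by
  intro a b c d
  simp only [auxBlock_Sq, smul_mul_assoc, mul_smul_comm, sub_mul, mul_sub, one_mul, mul_one,
    siteUnit_mul_siteUnit, eq_comm (a := c) (b := b)]
  module

theorem exchangeRel_prod_Sq (n N : ℕ) (θ : Fin n → ℂ) (z w : ℂ) (l : List (Fin n))
    (hl : l.Nodup) :
    ExchangeRel (z - w) (Complex.I * etaC N)
      (auxBlock (l.map fun i => Sq n N i (θ i - z)).prod)
      (auxBlock (l.map fun i => Sq n N i (θ i - w)).prod) := by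
  induction l with
  | nil =>
    intro a b c d
    simp only [List.map_nil, List.prod_nil, auxBlock_one, mul_smul_comm, mul_one]
    module
  | cons i l ih =>
    rw [List.nodup_cons] at hl
    simp only [List.map_cons, List.prod_cons, auxBlock_mul]
    have h := exchangeRel_Sq n N i (θ i - z) (θ i - w)
    rw [sub_sub_sub_cancel_left] at h
    exact h.mul (ih hl.2) (auxBlock_prod_Sq_commute _ _ l hl.1)
      (auxBlock_prod_Sq_commute _ _ l hl.1)

/-- The RTT relation for the components of the monodromy matrix. -/
theorem exchangeRel_Tcomp (n N : ℕ) (θ : Fin n → ℂ) (z w : ℂ) :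
    ExchangeRel (z - w) (Complex.I * etaC N) (Tcomp n N θ z) (Tcomp n N θ w) :=
  exchangeRel_prod_Sq n N θ z w _ (List.nodup_finRange n)

/-- Algebraic Bethe ansatz commutation relation (C–A):
C̃^β(θ,z) ∘ Ã(θ,w) = (1/b̃(w−z))·Ã(θ,w)∘C̃^β(θ,z) − (c̃(w−z)/b̃(w−z))·Ã(θ,z)∘C̃^β(θ,w). -/
theorem CA_commutation (n N : ℕ) [NeZero N] (hn : 1 ≤ n) (hN : 2 ≤ N)
    (θ : Fin n → ℂ) (z w : ℂ)
    (hz : ∀ i, θ i - z ≠ Complex.I * etaC N)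
    (hw : ∀ i, θ i - w ≠ Complex.I * etaC N)
    (hwz : w - z ≠ Complex.I * etaC N) (hne : w ≠ z)
    (β : Fin N) (hβ : β ≠ 0) :
    Ctilde n N θ z β * Atilde n N θ w =
      (btilde N (w - z))⁻¹ • (Atilde n N θ w * Ctilde n N θ z β) -
        (ctilde N (w - z) / btilde N (w - z)) • (Atilde n N θ z * Ctilde n N θ w β) := by
  have h := exchangeRel_Tcomp n N θ w z 0 0 β 0
  have hv : w - z ≠ 0 := sub_ne_zero.mpr hne
  have hk : w - z - Complex.I * etaC N ≠ 0 := sub_ne_zero.mpr hwz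
  have hb : (btilde N (w - z))⁻¹ = (w - z)⁻¹ * (w - z - Complex.I * etaC N) := by
    rw [btilde, inv_div, div_eq_inv_mul]
  have hc : ctilde N (w - z) / btilde N (w - z) = -((w - z)⁻¹ * (Complex.I * etaC N)) := by
    rw [ctilde, btilde, div_div_div_cancel_right₀ hk, neg_div, div_eq_inv_mul]
  have h' : (w - z) • (Ctilde n N θ z β * Atilde n N θ w) =
      (w - z - Complex.I * etaC N) • (Atilde n N θ w * Ctilde n N θ z β) +
        (Complex.I * etaC N) • (Atilde n N θ z * Ctilde n N θ w β) := by
    rw [sub_smul _ (Complex.I * etaC N)]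
    exact (sub_eq_iff_eq_add.mp h.symm)
  rw [hb, hc, neg_smul, sub_neg_eq_add, mul_smul, mul_smul, ← smul_add, ← h', inv_smul_smul₀ hv]
end
end

section
/- SU(2) minimal form factor equation: let N = 2, φ(θ) := Γ(θ/(2πi))·Γ(1/2 − θ/(2πi)), and let F be the minimal form factor with the normalization constant c₀ := Γ(1/4)^{−1} · exp(−∫₀^∞ e^{t/2}·( sinh(t/2)/(t·sinh²t) − 1/(2t·sinh t) ) dt). Then for every θ ∈ ℂ with 0 < Im θ < π one has φ(θ)·F(θ)·F(θ + iπ) = 1. -/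
open Complex MeasureTheory

noncomputable section

/-- The exponent integral I(θ) of the SU(2) minimal form factor. -/
def minFFexp (θ : ℂ) : ℂ :=
  ∫ t in Set.Ioi (0 : ℝ),
    Complex.exp ((t : ℂ) / 2) * Complex.sinh ((t : ℂ) * (1 - 1 / 2)) *
      (1 - Complex.cosh ((t : ℂ) * (1 - θ / ((Real.pi : ℂ) * Complex.I)))) /
        ((t : ℂ) * Complex.sinh (t : ℂ) ^ 2)

/-- The normalization constant c₀ = Γ(1/4)⁻¹·exp(−∫₀^∞ e^{t/2}(sinh(t/2)/(t sinh²t)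
− 1/(2t sinh t)) dt) of the SU(2) minimal form factor. -/
def minFFconst : ℂ :=
  (Complex.Gamma (1 / 4))⁻¹ *
    Complex.exp (-∫ t in Set.Ioi (0 : ℝ),
      Complex.exp ((t : ℂ) / 2) *
        (Complex.sinh ((t : ℂ) / 2) / ((t : ℂ) * Complex.sinh (t : ℂ) ^ 2) -
          1 / (2 * (t : ℂ) * Complex.sinh (t : ℂ))))

/-- The SU(2) minimal form factor F(θ) = c₀·exp(I(θ)). -/
def minFF (θ : ℂ) : ℂ := minFFconst * Complex.exp (minFFexp θ)

/-- The SU(2) Jost function φ(θ) = Γ(θ/(2πi))·Γ(1/2 − θ/(2πi)). -/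
def phiJost2 (θ : ℂ) : ℂ :=
  Complex.Gamma (θ / twoPiI) * Complex.Gamma (1 / 2 - θ / twoPiI)

open Filter Topology Set

theorem integrableOn_exp_neg_sub_exp_neg_div_and_exp_integral {a b : ℂ} (ha : 0 < a.re)
    (hb : 0 < b.re) :
    IntegrableOn (fun t : ℝ => (exp (-a * t) - exp (-b * t)) / t) (Ioi 0) ∧
      exp (∫ t : ℝ in Ioi 0, (exp (-a * t) - exp (-b * t)) / t) = b / a := by
  set c : ℝ → ℂ := fun u => a + u * (b - a) with hc
  set δ : ℝ := min a.re b.re with hδ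
  have hδ0 : 0 < δ := lt_min ha hb
  have hcre : ∀ u ∈ Icc (0 : ℝ) 1, δ ≤ (c u).re := by
    intro u hu
    have h1 : δ ≤ a.re := min_le_left _ _
    have h2 : δ ≤ b.re := min_le_right _ _
    have : (c u).re = (1 - u) * a.re + u * b.re := by simp [hc]; ring
    rw [this]
    nlinarith [hu.1, hu.2]
  have hc0 : ∀ u ∈ Icc (0 : ℝ) 1, c u ≠ 0 := by
    intro u hu h
    have := hcre u hu
    rw [h] at this
    simp at this
    linarith
  have hcd : ∀ u : ℝ, HasDerivAt c (b - a) u := fun u =>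
    (((hasDerivAt_id u).ofReal_comp.mul_const (b - a)).const_add a).congr_deriv (by simp)
  have hprodInt : Integrable (fun p : ℝ × ℝ => (b - a) * exp (-c p.2 * p.1))
      ((volume.restrict (Ioi (0 : ℝ))).prod (volume.restrict (Ioc (0 : ℝ) 1))) := by
    have hg : Integrable (fun p : ℝ × ℝ => (‖b - a‖ * Real.exp (-δ * p.1)) * (1 : ℝ))
        ((volume.restrict (Ioi (0 : ℝ))).prod (volume.restrict (Ioc (0 : ℝ) 1))) := by
      refine Integrable.mul_prod (f := fun t => ‖b - a‖ * Real.exp (-δ * t))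
        (g := fun _ => (1 : ℝ)) ?_ ?_
      · exact (integrableOn_exp_mul_Ioi (by linarith) 0).const_mul _
      · exact integrable_const _
    refine hg.mono' (by simp only [hc]; fun_prop) ?_
    rw [Measure.prod_restrict]
    refine ae_restrict_of_forall_mem (measurableSet_Ioi.prod measurableSet_Ioc) ?_
    rintro ⟨t, u⟩ ⟨ht, hu⟩
    have ht' : 0 < t := ht
    have := hcre u (Ioc_subset_Icc_self hu)
    simp only [norm_mul, mul_one, norm_exp]
    gcongr
    simp only [mul_re, neg_re, ofReal_re, neg_im, ofReal_im, mul_zero, sub_zero]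
    nlinarith
  have hinner : ∀ t ∈ Ioi (0 : ℝ), ∫ u : ℝ in Ioc 0 1, (b - a) * exp (-c u * t) =
      (exp (-a * t) - exp (-b * t)) / t := by
    intro t ht
    have ht' : (t : ℂ) ≠ 0 := ofReal_ne_zero.mpr (ne_of_gt ht)
    rw [← intervalIntegral.integral_of_le zero_le_one]
    rw [intervalIntegral.integral_eq_sub_of_hasDerivAt
      (f := fun u => -exp (-c u * t) / t)]
    · simp [hc]; ring
    · intro u _
      have := ((((hcd u).neg).mul_const (t : ℂ)).cexp.neg).div_const (t : ℂ)
      refine this.congr_deriv ?_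
      simp only [Pi.neg_apply]
      field_simp
    · refine Continuous.intervalIntegrable ?_ _ _
      simp only [hc]; fun_prop
  constructor
  · exact (hprodInt.integral_prod_left).congr
      (ae_restrict_of_forall_mem measurableSet_Ioi hinner)
  · rw [← setIntegral_congr_fun measurableSet_Ioi hinner, integral_integral_swap hprodInt]
    have h1 : ∀ u ∈ Ioc (0 : ℝ) 1, ∫ t : ℝ in Ioi 0, (b - a) * exp (-c u * t) =
        (b - a) / c u := by
      intro u hu
      have := hcre u (Ioc_subset_Icc_self hu)
      rw [integral_const_mul, integral_exp_mul_complex_Ioi (by simp; linarith)]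
      simp [div_eq_mul_inv]
    rw [setIntegral_congr_fun measurableSet_Ioc h1,
      ← intervalIntegral.integral_of_le zero_le_one,
      intervalIntegral.integral_eq_sub_of_hasDerivAt (f := fun u => log (c u))]
    · have ha0 : a ≠ 0 := by rintro rfl; simp at ha
      have hb0 : b ≠ 0 := by rintro rfl; simp at hb
      simp [hc, exp_sub, exp_log, ha0, hb0]
    · intro u hu
      rw [uIcc_of_le zero_le_one] at hu
      exact (hcd u).clog_real (Or.inl (hδ0.trans_le (hcre u hu)))
    · refine ContinuousOn.intervalIntegrable ?_
      rw [uIcc_of_le zero_le_one]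
      exact continuousOn_const.div (by simp only [hc]; fun_prop) hc0

theorem sinh_ofReal_ne_zero {t : ℝ} (ht : 0 < t) : sinh (t : ℂ) ≠ 0 := by
  rw [← ofReal_sinh]
  exact ofReal_ne_zero.mpr (Real.sinh_pos_iff.mpr ht).ne'

/-- The integrand of `minFFexp`, as a function of `v = 1 - θ / (iπ)`. -/
def minFFIntegrand (v : ℂ) (t : ℝ) : ℂ :=
  exp ((t : ℂ) / 2) * sinh ((t : ℂ) * (1 - 1 / 2)) * (1 - cosh ((t : ℂ) * v)) /
    ((t : ℂ) * sinh (t : ℂ) ^ 2)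

theorem norm_minFFIntegrand_le (v : ℂ) {t : ℝ} (ht : 0 < t) :
    ‖minFFIntegrand v t‖ ≤ ‖1 - cosh ((t : ℂ) * v)‖ / (t * Real.sinh t) := by
  have hs := Real.sinh_pos_iff.mpr ht
  have hs2 := Real.sinh_pos_iff.mpr (half_pos ht)
  have h : Real.exp (t / 2) * Real.sinh (t / 2) ≤ Real.sinh t := by
    have h2 : Real.sinh t = 2 * Real.sinh (t / 2) * Real.cosh (t / 2) := by
      rw [← Real.sinh_two_mul]; ring_nf
    rw [h2, Real.cosh_eq]
    nlinarith [Real.exp_pos (-(t / 2))]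
  have e : ‖minFFIntegrand v t‖ = (Real.exp (t / 2) * Real.sinh (t / 2)) *
      ‖1 - cosh ((t : ℂ) * v)‖ / (t * Real.sinh t ^ 2) := by
    have e1 : (t : ℂ) * (1 - 1 / 2) = ((t / 2 : ℝ) : ℂ) := by push_cast; ring
    have e2 : (t : ℂ) / 2 = ((t / 2 : ℝ) : ℂ) := by push_cast; ring
    rw [minFFIntegrand, e1, e2, ← ofReal_sinh, ← ofReal_sinh, ← ofReal_exp]
    simp only [norm_mul, norm_div, norm_pow, norm_real, Real.norm_eq_abs, abs_of_pos ht,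
      abs_of_pos hs, abs_of_pos hs2, Real.abs_exp]
  rw [e, div_le_div_iff₀ (by positivity) (by positivity)]
  have : 0 ≤ ‖1 - cosh ((t : ℂ) * v)‖ * t * Real.sinh t := by positivity
  nlinarith

theorem norm_one_sub_cosh_le_sq {z : ℂ} (hz : ‖z‖ ≤ 1) : ‖1 - cosh z‖ ≤ ‖z‖ ^ 2 := by
  have h1 := norm_exp_sub_one_sub_id_le hz
  have h2 := norm_exp_sub_one_sub_id_le (x := -z) (by simpa)
  rw [norm_neg] at h2
  have : 1 - cosh z = -((exp z - 1 - z) + (exp (-z) - 1 - -z)) / 2 := by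
    rw [cosh]; ring
  rw [this, norm_div, norm_neg, RCLike.norm_ofNat]
  linarith [norm_add_le (exp z - 1 - z) (exp (-z) - 1 - -z)]

theorem norm_one_sub_cosh_le_exp (z : ℂ) : ‖1 - cosh z‖ ≤ 2 * Real.exp |z.re| := by
  have h0 := Real.one_le_exp (abs_nonneg z.re)
  have h1 : ‖exp z‖ ≤ Real.exp |z.re| := by
    rw [norm_exp]; exact Real.exp_le_exp.mpr (le_abs_self _)
  have h2 : ‖exp (-z)‖ ≤ Real.exp |z.re| := by
    rw [norm_exp]; exact Real.exp_le_exp.mpr (by simpa using neg_le_abs _)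
  have h3 : ‖cosh z‖ ≤ Real.exp |z.re| := by
    rw [cosh, norm_div, RCLike.norm_ofNat]
    linarith [norm_add_le (exp z) (exp (-z))]
  have := norm_sub_le 1 (cosh z)
  rw [norm_one] at this
  linarith

theorem integrableOn_minFFIntegrand {v : ℂ} (hv : |v.re| < 1) :
    IntegrableOn (minFFIntegrand v) (Ioi 0) := by
  have hcont : ContinuousOn (minFFIntegrand v) (Ioi 0) := by
    unfold minFFIntegrand
    refine ContinuousOn.div (by fun_prop) (by fun_prop) fun t ht => ?_
    exact mul_ne_zero (ofReal_ne_zero.mpr (ne_of_gt ht)) (pow_ne_zero _ (sinh_ofReal_ne_zero ht))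
  have htop : minFFIntegrand v =O[atTop] fun t => Real.exp (-(1 - |v.re|) * t) := by
    refine Asymptotics.IsBigO.of_bound 8 ?_
    filter_upwards [eventually_ge_atTop 1] with t ht
    have ht0 : 0 < t := by linarith
    refine (norm_minFFIntegrand_le v ht0).trans ?_
    have hs : Real.exp t / 4 ≤ t * Real.sinh t := by
      have h1 : Real.exp t / 4 ≤ Real.sinh t := by
        rw [Real.sinh_eq]
        have := Real.add_one_le_exp t
        have h2 : Real.exp (-t) ≤ 1 := Real.exp_le_one_iff.mpr (by linarith)
        linarith
      nlinarith [Real.exp_pos t]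
    have hn : ‖1 - cosh ((t : ℂ) * v)‖ ≤ 2 * Real.exp (|v.re| * t) := by
      refine (norm_one_sub_cosh_le_exp _).trans_eq ?_
      simp [abs_mul, abs_of_pos ht0, mul_comm]
    rw [Real.norm_eq_abs, Real.abs_exp]
    calc _ ≤ (2 * Real.exp (|v.re| * t)) / (Real.exp t / 4) := by gcongr
      _ = 8 * (Real.exp (|v.re| * t) / Real.exp t) := by ring
      _ = _ := by rw [← Real.exp_sub]; ring_nf
  have hbot : minFFIntegrand v =O[𝓝[>] 0] (fun t : ℝ => t ^ (-(0 : ℝ))) := by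
    refine Asymptotics.IsBigO.of_bound (‖v‖ ^ 2) ?_
    have hpos : (0 : ℝ) < 1 / (‖v‖ + 1) := by positivity
    filter_upwards [Ioo_mem_nhdsGT hpos] with t ht
    have ht0 : 0 < t := ht.1
    have hs : t ≤ Real.sinh t := Real.self_le_sinh_iff.mpr ht0.le
    refine (norm_minFFIntegrand_le v ht0).trans ?_
    have hz : ‖(t : ℂ) * v‖ = t * ‖v‖ := by simp [abs_of_pos ht0]
    have hz1 : ‖(t : ℂ) * v‖ ≤ 1 := by
      have := (lt_div_iff₀ (by positivity)).mp ht.2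
      rw [hz]; linarith
    have := norm_one_sub_cosh_le_sq hz1
    rw [hz] at this
    rw [neg_zero, Real.rpow_zero, norm_one, mul_one, div_le_iff₀ (by positivity)]
    nlinarith [mul_nonneg (sq_nonneg ‖v‖) (mul_nonneg ht0.le (sub_nonneg.mpr hs))]
  have := mellinConvergent_of_isBigO_rpow_exp (s := 1) (by linarith)
    (hcont.locallyIntegrableOn measurableSet_Ioi) htop hbot (by simp)
  simpa [MellinConvergent] using this

/-- The integrand whose integral is the logarithm of
`Γ(1/4)² / (Γ(1/4 - w/2) Γ(1/4 + w/2))`. -/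
def jostIntegrand (w : ℂ) (t : ℝ) : ℂ :=
  exp ((t : ℂ) / 2) * (1 - cosh ((t : ℂ) * w)) / ((t : ℂ) * sinh (t : ℂ))

theorem minFFIntegrand_neg (v : ℂ) : minFFIntegrand (-v) = minFFIntegrand v := by
  ext t
  simp [minFFIntegrand]

theorem exp_half_pow_two (z : ℂ) : exp z = exp (z / 2) ^ 2 := by
  rw [← exp_nat_mul]; congr 1; push_cast; ring

theorem exp_half_pow_four_ne_one {t : ℝ} (ht : 0 < t) : exp ((t : ℂ) / 2) ^ 4 - 1 ≠ 0 := by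
  intro h
  apply sinh_ofReal_ne_zero ht
  rw [sinh, exp_neg, exp_half_pow_two (t : ℂ)]
  have := exp_ne_zero ((t : ℂ) / 2)
  field_simp
  linear_combination h

theorem jostIntegrand_eq (w : ℂ) {t : ℝ} (ht : 0 < t) :
    jostIntegrand w t = minFFIntegrand (1 / 2 - w) t + minFFIntegrand (1 / 2 + w) t
      - 2 * minFFIntegrand (1 / 2) t := by
  have ht' : (t : ℂ) ≠ 0 := ofReal_ne_zero.mpr ht.ne'
  have hs := sinh_ofReal_ne_zero ht
  have e1 : (t : ℂ) * (1 - 1 / 2) = t / 2 := by ring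
  have e2 : (t : ℂ) * (1 / 2) = t / 2 := by ring
  have e3 : cosh ((t : ℂ) * (1 / 2 - w)) + cosh ((t : ℂ) * (1 / 2 + w)) =
      2 * cosh ((t : ℂ) / 2) * cosh (t * w) := by
    rw [mul_sub, mul_add, e2, cosh_sub, cosh_add]; ring
  have e4 : sinh (t : ℂ) = 2 * sinh ((t : ℂ) / 2) * cosh ((t : ℂ) / 2) := by
    rw [← sinh_two_mul]; ring_nf
  simp only [jostIntegrand, minFFIntegrand, e1, e2]
  generalize cosh ((t : ℂ) * (1 / 2 - w)) = x at *
  generalize cosh ((t : ℂ) * (1 / 2 + w)) = y at *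
  field_simp
  linear_combination (1 - cosh (t * w)) * e4 + sinh ((t : ℂ) / 2) * e3

theorem integrableOn_jostIntegrand {w : ℂ} (hw : |w.re| < 1 / 2) :
    IntegrableOn (jostIntegrand w) (Ioi 0) := by
  obtain ⟨h1, h2⟩ := abs_lt.mp hw
  refine IntegrableOn.congr_fun (f := fun t => minFFIntegrand (1 / 2 - w) t +
    minFFIntegrand (1 / 2 + w) t - 2 * minFFIntegrand (1 / 2) t) ?_
    (fun t ht => (jostIntegrand_eq w ht).symm) measurableSet_Ioi
  refine ((integrableOn_minFFIntegrand ?_).add (integrableOn_minFFIntegrand ?_)).sub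
    ((integrableOn_minFFIntegrand ?_).const_mul 2)
  all_goals
    rw [abs_lt]
    constructor <;> norm_num <;> linarith

/-- The tail integrals obtained by peeling off terms of the geometric series of
`1 / (1 - e^{-2t})`. -/
def jostTail (w : ℂ) (n : ℕ) : ℂ :=
  ∫ t : ℝ in Ioi 0, exp (-(2 * n : ℂ) * t) * jostIntegrand w t

theorem norm_exp_neg_two_mul_nat_le (n : ℕ) {t : ℝ} (ht : 0 < t) :
    ‖exp (-(2 * n : ℂ) * t)‖ ≤ 1 := by
  rw [norm_exp, Real.exp_le_one_iff]
  simp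
  positivity

theorem integrableOn_jostTail {w : ℂ} (hw : |w.re| < 1 / 2) (n : ℕ) :
    IntegrableOn (fun t : ℝ => exp (-(2 * n : ℂ) * t) * jostIntegrand w t) (Ioi 0) := by
  refine (integrableOn_jostIntegrand hw).bdd_mul (c := 1)
    (Continuous.aestronglyMeasurable (by fun_prop)) ?_
  exact ae_restrict_of_forall_mem measurableSet_Ioi fun t ht => norm_exp_neg_two_mul_nat_le n ht

theorem tendsto_jostTail {w : ℂ} (hw : |w.re| < 1 / 2) :
    Tendsto (jostTail w) atTop (𝓝 0) := by
  have := tendsto_integral_of_dominated_convergence (μ := volume.restrict (Ioi (0 : ℝ)))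
    (F := fun (n : ℕ) (t : ℝ) => exp (-(2 * n : ℂ) * t) * jostIntegrand w t) (f := fun _ => 0)
    (fun t => ‖jostIntegrand w t‖) (fun n => (integrableOn_jostTail hw n).aestronglyMeasurable)
    (integrableOn_jostIntegrand hw).norm
    (fun n => ae_restrict_of_forall_mem measurableSet_Ioi fun t ht => by
      rw [norm_mul]
      exact mul_le_of_le_one_left (norm_nonneg _) (norm_exp_neg_two_mul_nat_le n ht))
    (ae_restrict_of_forall_mem measurableSet_Ioi fun t ht => ?_)
  · rwa [integral_zero] at this
  · have ht' : (0 : ℝ) < t := ht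
    have h : Tendsto (fun n : ℕ => exp (-(2 * n : ℂ) * t)) atTop (𝓝 0) := by
      rw [tendsto_exp_nhds_zero_iff]
      have : Tendsto (fun n : ℕ => (n : ℝ) * (-2 * t)) atTop atBot :=
        tendsto_natCast_atTop_atTop.atTop_mul_const_of_neg (by linarith)
      refine this.congr fun n => ?_
      simp
      ring
    simpa using h.mul_const (jostIntegrand w t)

theorem exp_mul_jostIntegrand_eq (w : ℂ) (n : ℕ) {t : ℝ} (ht : 0 < t) :
    exp (-(2 * n : ℂ) * t) * jostIntegrand w t =
      (exp (-(2 * n + 1 / 2 : ℂ) * t) - exp (-(2 * n + 1 / 2 - w : ℂ) * t)) / t +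
      (exp (-(2 * n + 1 / 2 : ℂ) * t) - exp (-(2 * n + 1 / 2 + w : ℂ) * t)) / t +
      exp (-(2 * (n + 1 : ℕ) : ℂ) * t) * jostIntegrand w t := by
  have ht' : (t : ℂ) ≠ 0 := ofReal_ne_zero.mpr ht.ne'
  have hs := sinh_ofReal_ne_zero ht
  have h4 := exp_half_pow_four_ne_one ht
  have hy := exp_ne_zero ((t : ℂ) / 2)
  have hu := exp_ne_zero ((t : ℂ) * w)
  have e1 : exp (-(2 * n + 1 / 2 : ℂ) * t) = exp (-(2 * n : ℂ) * t) * (exp ((t : ℂ) / 2))⁻¹ := by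
    rw [← exp_neg, ← exp_add]; ring_nf
  have e2 : exp (-(2 * n + 1 / 2 - w : ℂ) * t) =
      exp (-(2 * n : ℂ) * t) * (exp ((t : ℂ) / 2))⁻¹ * exp (t * w) := by
    rw [← exp_neg, ← exp_add, ← exp_add]; ring_nf
  have e3 : exp (-(2 * n + 1 / 2 + w : ℂ) * t) =
      exp (-(2 * n : ℂ) * t) * (exp ((t : ℂ) / 2))⁻¹ * (exp (t * w))⁻¹ := by
    rw [← exp_neg, ← exp_neg, ← exp_add, ← exp_add]; ring_nf
  have e4 : exp (-(2 * (n + 1 : ℕ) : ℂ) * t) =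
      exp (-(2 * n : ℂ) * t) * (exp ((t : ℂ) / 2) ^ 4)⁻¹ := by
    rw [← exp_nat_mul, ← exp_neg, ← exp_add]; push_cast; ring_nf
  have e5 : sinh (t : ℂ) = (exp ((t : ℂ) / 2) ^ 4 - 1) / (2 * exp ((t : ℂ) / 2) ^ 2) := by
    rw [sinh, exp_neg, exp_half_pow_two (t : ℂ)]
    field_simp
  rw [e1, e2, e3, e4, jostIntegrand, e5, cosh, exp_neg]
  generalize exp ((t : ℂ) / 2) = y at *
  generalize exp ((t : ℂ) * w) = u at *
  generalize exp (-(2 * n : ℂ) * t) = x at *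
  field_simp
  ring

theorem exp_jostTail_succ {w : ℂ} (hw : |w.re| < 1 / 2) (n : ℕ) :
    exp (jostTail w n) = (2 * n + 1 / 2 - w) / (2 * n + 1 / 2) *
      ((2 * n + 1 / 2 + w) / (2 * n + 1 / 2)) * exp (jostTail w (n + 1)) := by
  obtain ⟨h1, h2⟩ := abs_lt.mp hw
  have hn : (0 : ℝ) ≤ n := n.cast_nonneg
  obtain ⟨i1, f1⟩ := integrableOn_exp_neg_sub_exp_neg_div_and_exp_integral
    (a := 2 * n + 1 / 2) (b := 2 * n + 1 / 2 - w) (by norm_num; linarith) (by norm_num; linarith)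
  obtain ⟨i2, f2⟩ := integrableOn_exp_neg_sub_exp_neg_div_and_exp_integral
    (a := 2 * n + 1 / 2) (b := 2 * n + 1 / 2 + w) (by norm_num; linarith) (by norm_num; linarith)
  rw [← f1, ← f2, ← exp_add, ← exp_add, jostTail, jostTail,
    setIntegral_congr_fun measurableSet_Ioi fun t ht => exp_mul_jostIntegrand_eq w n ht,
    ← integral_add i1 i2]
  exact congrArg exp (integral_add (i1.add i2) (integrableOn_jostTail hw (n + 1)))

theorem exp_jostTail_zero {w : ℂ} (hw : |w.re| < 1 / 2) (m : ℕ) :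
    exp (jostTail w 0) = (∏ n ∈ Finset.range m, ((2 * n + 1 / 2 - w) / (2 * n + 1 / 2) *
      ((2 * n + 1 / 2 + w) / (2 * n + 1 / 2)) : ℂ)) * exp (jostTail w m) := by
  induction m with
  | zero => simp
  | succ m ih => rw [ih, Finset.prod_range_succ, exp_jostTail_succ hw m, ← mul_assoc]

theorem prod_mul_GammaSeq {w : ℂ} (hw : |w.re| < 1 / 2) {n : ℕ} (hn : n ≠ 0) :
    (∏ j ∈ Finset.range (n + 1), ((2 * j + 1 / 2 - w) / (2 * j + 1 / 2) *
      ((2 * j + 1 / 2 + w) / (2 * j + 1 / 2)) : ℂ)) *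
      (GammaSeq (1 / 4 - w / 2) n * GammaSeq (1 / 4 + w / 2) n) = GammaSeq (1 / 4) n ^ 2 := by
  obtain ⟨h1, h2⟩ := abs_lt.mp hw
  have hn' : (n : ℂ) ≠ 0 := Nat.cast_ne_zero.mpr hn
  have hpow : (n : ℂ) ^ (1 / 4 - w / 2) * (n : ℂ) ^ (1 / 4 + w / 2) =
      ((n : ℂ) ^ (1 / 4 : ℂ)) ^ 2 := by
    rw [← cpow_add _ _ hn', sq, ← cpow_add _ _ hn']; ring_nf
  have ne : ∀ {z : ℂ}, 0 < z.re → ∏ j ∈ Finset.range (n + 1), (z + j) ≠ 0 := by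
    intro z hz
    refine Finset.prod_ne_zero_iff.mpr fun j _ h => ?_
    have := congrArg re h
    have hj : (0 : ℝ) ≤ j := j.cast_nonneg
    simp at this
    linarith
  have n1 := ne (z := 1 / 4 - w / 2) (by norm_num; linarith)
  have n2 := ne (z := 1 / 4 + w / 2) (by norm_num; linarith)
  have n3 := ne (z := 1 / 4) (by norm_num)
  have hprod : (∏ j ∈ Finset.range (n + 1), ((2 * j + 1 / 2 - w) / (2 * j + 1 / 2) *
      ((2 * j + 1 / 2 + w) / (2 * j + 1 / 2)) : ℂ)) =
      (∏ j ∈ Finset.range (n + 1), ((1 / 4 - w / 2) + j : ℂ)) *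
      (∏ j ∈ Finset.range (n + 1), ((1 / 4 + w / 2) + j : ℂ)) /
      (∏ j ∈ Finset.range (n + 1), ((1 / 4) + j : ℂ)) ^ 2 := by
    rw [← Finset.prod_mul_distrib, ← Finset.prod_pow, ← Finset.prod_div_distrib]
    refine Finset.prod_congr rfl fun j hj => ?_
    have h0 := Finset.prod_ne_zero_iff.mp n3 j hj
    have h0' : (2 * j + 1 / 2 : ℂ) ≠ 0 := by
      intro h; apply h0; linear_combination h / 2
    field_simp
    ring
  rw [hprod, GammaSeq, GammaSeq, GammaSeq]
  generalize ∏ j ∈ Finset.range (n + 1), ((1 / 4 - w / 2) + j : ℂ) = p at *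
  generalize ∏ j ∈ Finset.range (n + 1), ((1 / 4 + w / 2) + j : ℂ) = q at *
  generalize ∏ j ∈ Finset.range (n + 1), ((1 / 4) + j : ℂ) = r at *
  generalize (n : ℂ) ^ (1 / 4 - w / 2) = x at *
  generalize (n : ℂ) ^ (1 / 4 + w / 2) = y at *
  field_simp
  linear_combination (n.factorial : ℂ) ^ 2 * hpow

theorem exp_integral_jostIntegrand {w : ℂ} (hw : |w.re| < 1 / 2) :
    exp (∫ t : ℝ in Ioi 0, jostIntegrand w t) *
      (Gamma (1 / 4 - w / 2) * Gamma (1 / 4 + w / 2)) = Gamma (1 / 4) ^ 2 := by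
  have h0 : ∫ t : ℝ in Ioi 0, jostIntegrand w t = jostTail w 0 := by simp [jostTail]
  rw [h0]
  have hG := ((GammaSeq_tendsto_Gamma (1 / 4 - w / 2)).mul
    (GammaSeq_tendsto_Gamma (1 / 4 + w / 2))).const_mul (exp (jostTail w 0))
  have hT : Tendsto (fun n : ℕ => exp (jostTail w (n + 1))) atTop (𝓝 1) := by
    simpa using ((tendsto_jostTail hw).comp (tendsto_add_atTop_nat 1)).cexp
  refine tendsto_nhds_unique hG ?_
  have := ((GammaSeq_tendsto_Gamma (1 / 4)).pow 2).mul hT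
  rw [mul_one] at this
  refine this.congr' ?_
  filter_upwards [eventually_ne_atTop 0] with n hn
  rw [exp_jostTail_zero hw (n + 1), ← prod_mul_GammaSeq hw hn]
  ring

theorem minFFconst_eq :
    minFFconst = (Gamma (1 / 4))⁻¹ * exp (-∫ t : ℝ in Ioi 0, minFFIntegrand (1 / 2) t) := by
  rw [minFFconst]
  congr 3
  refine setIntegral_congr_fun measurableSet_Ioi fun t ht => ?_
  have ht' : (t : ℂ) ≠ 0 := ofReal_ne_zero.mpr (ne_of_gt ht)
  have hs := sinh_ofReal_ne_zero ht
  have e1 : (t : ℂ) * (1 - 1 / 2) = t / 2 := by ring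
  have e2 : (t : ℂ) * (1 / 2) = t / 2 := by ring
  have e4 : sinh (t : ℂ) = 2 * sinh ((t : ℂ) / 2) * cosh ((t : ℂ) / 2) := by
    rw [← sinh_two_mul]; ring_nf
  simp only [minFFIntegrand, e1, e2]
  field_simp
  linear_combination -e4

/-- SU(2) minimal form factor equation: φ(θ)·F(θ)·F(θ + iπ) = 1 for 0 < Im θ < π. -/
theorem minFF_equation_SU2 (θ : ℂ) (h1 : 0 < θ.im) (h2 : θ.im < Real.pi) :
    phiJost2 θ * minFF θ * minFF (θ + (Real.pi : ℂ) * Complex.I) = 1 := by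
  have hpi := Real.pi_pos
  have hpi' : (Real.pi : ℂ) ≠ 0 := ofReal_ne_zero.mpr hpi.ne'
  set w : ℂ := θ / ((Real.pi : ℂ) * I) - 1 / 2 with hw_def
  have hwre : w.re = θ.im / Real.pi - 1 / 2 := by
    have : θ / ((Real.pi : ℂ) * I) = -(θ * I) / (Real.pi : ℂ) := by
      field_simp; simp
    rw [hw_def, sub_re, this, div_ofReal_re]
    norm_num
  have hx0 : 0 < θ.im / Real.pi := by positivity
  have hx1 : θ.im / Real.pi < 1 := (div_lt_one hpi).mpr h2
  have hw : |w.re| < 1 / 2 := by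
    rw [hwre, abs_lt]; constructor <;> linarith
  obtain ⟨hw1, hw2⟩ := abs_lt.mp hw
  have I1 : minFFexp θ = ∫ t : ℝ in Ioi 0, minFFIntegrand (1 / 2 - w) t := by
    have : 1 / 2 - w = 1 - θ / ((Real.pi : ℂ) * I) := by rw [hw_def]; ring
    rw [this]; rfl
  have I2 : minFFexp (θ + (Real.pi : ℂ) * I) =
      ∫ t : ℝ in Ioi 0, minFFIntegrand (1 / 2 + w) t := by
    have : -(1 / 2 + w) = 1 - (θ + (Real.pi : ℂ) * I) / ((Real.pi : ℂ) * I) := by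
      rw [hw_def]; field_simp; ring
    rw [← minFFIntegrand_neg, this]; rfl
  have hre : ∀ v : ℂ, -1 < v.re → v.re < 1 → IntegrableOn (minFFIntegrand v) (Ioi 0) :=
    fun v a b => integrableOn_minFFIntegrand (abs_lt.mpr ⟨a, b⟩)
  have j1 := hre (1 / 2 - w) (by norm_num; linarith) (by norm_num; linarith)
  have j2 := hre (1 / 2 + w) (by norm_num; linarith) (by norm_num; linarith)
  have j3 := hre (1 / 2) (by norm_num) (by norm_num)
  have hJ : ∫ t : ℝ in Ioi 0, jostIntegrand w t =
      (∫ t : ℝ in Ioi 0, minFFIntegrand (1 / 2 - w) t) +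
      (∫ t : ℝ in Ioi 0, minFFIntegrand (1 / 2 + w) t) -
      2 * ∫ t : ℝ in Ioi 0, minFFIntegrand (1 / 2) t := by
    rw [setIntegral_congr_fun measurableSet_Ioi fun t ht => jostIntegrand_eq w ht,
      ← integral_add j1 j2, ← integral_const_mul]
    exact integral_sub (j1.add j2) (j3.const_mul 2)
  have hphi : phiJost2 θ = Gamma (1 / 4 - w / 2) * Gamma (1 / 4 + w / 2) := by
    have : θ / twoPiI = 1 / 4 + w / 2 := by
      rw [twoPiI, hw_def]; field_simp; ring
    rw [phiJost2, this, mul_comm]; ring_nf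
  have hΓ : Gamma (1 / 4 : ℂ) ≠ 0 := Gamma_ne_zero_of_re_pos (by norm_num)
  have key := exp_integral_jostIntegrand hw
  rw [hJ, exp_sub, exp_add, two_mul, exp_add] at key
  rw [minFF, minFF, I1, I2, minFFconst_eq, hphi, exp_neg]
  have hE := exp_ne_zero (∫ t : ℝ in Ioi 0, minFFIntegrand (1 / 2) t)
  field_simp at key ⊢
  linear_combination key
end
end

section
/- SU(2) crossing relation of the S-matrix entries: let N = 2 (η = π). For every θ ∈ ℂ for which all amplitude values occurring are defined, and for all α, β, γ, δ ∈ {1,2}: δ_{αγ}δ_{βδ}·b(θ) + δ_{αδ}δ_{βγ}·c(θ) = −( δ_{αγ}δ_{βδ}·b(iπ − θ) + ε^{δγ}·ε_{αβ}·c(iπ − θ) ), where ε_{αβ} is antisymmetric with ε_{12} = 1 and ε^{αβ} is antisymmetric with ε^{21} = 1. -/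
open Complex

noncomputable section

/-- The SU(2) highest weight amplitude a(θ) (η = π). -/
def aAmp2 (θ : ℂ) : ℂ :=
  -(Complex.Gamma (1 - θ / twoPiI) * Complex.Gamma (1 / 2 + θ / twoPiI)) /
    (Complex.Gamma (1 + θ / twoPiI) * Complex.Gamma (1 / 2 - θ / twoPiI))

/-- The SU(2) amplitude b(θ) = a(θ)·θ/(θ − iπ). -/
def bAmp2 (θ : ℂ) : ℂ := aAmp2 θ * θ / (θ - Complex.I * (Real.pi : ℂ))

/-- The SU(2) amplitude c(θ) = −iπ·a(θ)/(θ − iπ). -/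
def cAmp2 (θ : ℂ) : ℂ :=
  -(Complex.I * (Real.pi : ℂ)) * aAmp2 θ / (θ - Complex.I * (Real.pi : ℂ))

/-- All Gamma factors in the SU(2) amplitudes at θ are defined, the denominator
Gammas are nonzero, and the denominator θ − iπ is nonzero. -/
def ampDefined2 (θ : ℂ) : Prop :=
  GammaDefined (1 - θ / twoPiI) ∧ GammaDefined (1 / 2 + θ / twoPiI) ∧
    GammaDefined (1 + θ / twoPiI) ∧ GammaDefined (1 / 2 - θ / twoPiI) ∧
    Complex.Gamma (1 + θ / twoPiI) ≠ 0 ∧ Complex.Gamma (1 / 2 - θ / twoPiI) ≠ 0 ∧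
    θ ≠ Complex.I * (Real.pi : ℂ)

/-- The antisymmetric ε-tensor with lower indices, ε₁₂ = 1 (indices 0-based). -/
def epsLo (α β : Fin 2) : ℂ :=
  if α = 0 ∧ β = 1 then 1 else if α = 1 ∧ β = 0 then -1 else 0

/-- The antisymmetric ε-tensor with upper indices, ε²¹ = 1 (indices 0-based). -/
def epsHi (α β : Fin 2) : ℂ :=
  if α = 1 ∧ β = 0 then 1 else if α = 0 ∧ β = 1 then -1 else 0

/-- Crossing of the highest weight amplitude: `(iπ - θ) a(iπ - θ) = θ a(θ)`. -/
theorem aAmp2_crossing {θ : ℂ} (h0 : θ ≠ 0) (hpi : θ ≠ I * (Real.pi : ℂ)) :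
    ((Real.pi : ℂ) * I - θ) * aAmp2 ((Real.pi : ℂ) * I - θ) = θ * aAmp2 θ := by
  obtain ⟨x, rfl⟩ : ∃ x, θ = twoPiI * x :=
    ⟨θ / twoPiI, (mul_div_cancel₀ θ twoPiI_ne_zero).symm⟩
  have hhalf : (Real.pi : ℂ) * I = twoPiI * (1 / 2) := by unfold twoPiI; ring
  have hx : x ≠ 0 := right_ne_zero_of_mul h0
  have hy : 1 / 2 - x ≠ 0 := fun h => hpi (by
    rw [mul_comm I, hhalf, sub_eq_zero.mp h])
  rw [hhalf, ← mul_sub]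
  unfold aAmp2
  rw [mul_div_cancel_left₀ _ twoPiI_ne_zero, mul_div_cancel_left₀ _ twoPiI_ne_zero,
    show 1 - (1 / 2 - x) = 1 / 2 + x by ring, show 1 / 2 + (1 / 2 - x) = 1 - x by ring,
    show 1 / 2 - (1 / 2 - x) = x by ring, add_comm 1 (1 / 2 - x), add_comm 1 x,
    Complex.Gamma_add_one _ hy, Complex.Gamma_add_one _ hx]
  generalize 1 / 2 - x = y at hy ⊢
  generalize Gamma (1 / 2 + x) = g
  simp only [div_eq_mul_inv, mul_inv]
  linear_combination (-twoPiI * Gamma (1 - x) * g * (Gamma x)⁻¹ * (Gamma y)⁻¹) *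
    (mul_inv_cancel₀ hy - mul_inv_cancel₀ hx)

theorem cAmp2_crossing {θ : ℂ} (h0 : θ ≠ 0) (hpi : θ ≠ I * (Real.pi : ℂ)) :
    cAmp2 ((Real.pi : ℂ) * I - θ) = cAmp2 θ := by
  have h := aAmp2_crossing h0 hpi
  have hd := sub_ne_zero.mpr hpi
  unfold cAmp2
  rw [show (Real.pi : ℂ) * I - θ - I * (Real.pi : ℂ) = -θ by ring,
    div_eq_div_iff (neg_ne_zero.mpr h0) hd]
  linear_combination (I * (Real.pi : ℂ)) * h

theorem bAmp2_crossing {θ : ℂ} (h0 : θ ≠ 0) (hpi : θ ≠ I * (Real.pi : ℂ)) :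
    bAmp2 ((Real.pi : ℂ) * I - θ) = -(bAmp2 θ + cAmp2 θ) := by
  have h := aAmp2_crossing h0 hpi
  have hd := sub_ne_zero.mpr hpi
  unfold bAmp2 cAmp2
  rw [show (Real.pi : ℂ) * I - θ - I * (Real.pi : ℂ) = -θ by ring, ← add_div, ← neg_div,
    div_eq_div_iff (neg_ne_zero.mpr h0) hd]
  linear_combination (θ - I * (Real.pi : ℂ)) * h

/-- SU(2) crossing relation of the S-matrix entries:
S^{δγ}_{αβ}(θ) = −(δ_{αγ}δ_{βδ}·b(iπ−θ) + ε^{δγ}·ε_{αβ}·c(iπ−θ)). -/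
theorem crossing_SU2 (θ : ℂ)
    (h1 : ampDefined2 θ) (h2 : ampDefined2 ((Real.pi : ℂ) * Complex.I - θ))
    (α β γ δ : Fin 2) :
    (if α = γ then 1 else 0) * (if β = δ then 1 else 0) * bAmp2 θ +
        (if α = δ then 1 else 0) * (if β = γ then 1 else 0) * cAmp2 θ =
      -((if α = γ then 1 else 0) * (if β = δ then 1 else 0) *
            bAmp2 ((Real.pi : ℂ) * Complex.I - θ) +
          epsHi δ γ * epsLo α β * cAmp2 ((Real.pi : ℂ) * Complex.I - θ)) := by
  have hpi : θ ≠ I * (Real.pi : ℂ) := h1.2.2.2.2.2.2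
  have h0 : θ ≠ 0 := fun h => h2.2.2.2.2.2.2 (by rw [h]; ring)
  rw [bAmp2_crossing h0 hpi, cAmp2_crossing h0 hpi]
  fin_cases α <;> fin_cases β <;> fin_cases γ <;> fin_cases δ <;> simp [epsLo, epsHi]
end
end
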